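/- arXiv:1902.04131 — 4 statements merged into one kernel-verified Lean document; each statement's English description precedes it below -/
import Mathlib

section
/- A countable discrete group G is inner amenable if and only if for every finite subset F ⊆ G, every ε > 0, and every n ∈ ℕ there exists a finite subset W ⊆ G with |W| ≥ n such that |sWs^{-1} Δ W| < ε|W| for all s ∈ F. -/
/-- A mean on a set `Z`: a finitely additive probability measure defined on all subsets. -/
def IsMean {Z : Type*} (m : Set Z → ℝ) : Prop :=
  m Set.univ = 1 ∧ (∀ A : Set Z, 0 ≤ m A) ∧
    ∀ A B : Set Z, Disjoint A B → m (A ∪ B) = m A + m B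

/-- A group is inner amenable if there is an atomless conjugation-invariant mean on it. -/
def InnerAmenable (G : Type*) [Group G] : Prop :=
  ∃ m : Set G → ℝ, IsMean m ∧ (∀ A : Set G, A.Finite → m A = 0) ∧
    ∀ (g : G) (A : Set G), m ((fun h => g * h * g⁻¹) '' A) = m A

open Filter Topology

section Mean

variable {X : Type*} {m : Set X → ℝ}

lemma IsMean.empty (hm : IsMean m) : m ∅ = 0 := by
  have h := hm.2.2 ∅ ∅ (by simp)
  simp only [Set.union_empty] at h
  linarith

/-- A mean is determined on preimages of finite sets by its values on fibres. -/
lemma IsMean.preimage_finset (hm : IsMean m) {T : Type*} [DecidableEq T] (Φ : X → T)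
    (A : Finset T) : m (Φ ⁻¹' A) = ∑ t ∈ A, m (Φ ⁻¹' {t}) := by
  induction A using Finset.induction_on with
  | empty => simpa using hm.empty
  | insert a A ha ih =>
    rw [Finset.sum_insert ha, ← ih, ← hm.2.2 _ _
      (Disjoint.preimage Φ (by simpa using ha)), ← Set.preimage_union,
      Finset.coe_insert, Set.insert_eq]

/-- Change of variables for the integral, against a mean, of a function with finite range. -/
lemma IsMean.sum_comp (hm : IsMean m) {T T' : Type*} [Fintype T] [Fintype T'] [DecidableEq T]
    [DecidableEq T'] (Φ : X → T) (π : T → T') (w : T' → ℝ) :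
    ∑ t, m (Φ ⁻¹' {t}) * w (π t) = ∑ t', m ((π ∘ Φ) ⁻¹' {t'}) * w t' := by
  rw [← Finset.sum_fiberwise Finset.univ π]
  refine Finset.sum_congr rfl fun t' _ => ?_
  have h : (π ∘ Φ) ⁻¹' {t'} = Φ ⁻¹' (Finset.univ.filter fun t => π t = t' : Finset T) := by
    ext x; simp
  rw [h, hm.preimage_finset, Finset.sum_mul]
  refine Finset.sum_congr rfl fun t ht => ?_
  rw [(Finset.mem_filter.1 ht).2]

/-- Against an invariant atomless mean, a sum of bounded coboundaries has integral zero, hence is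
smaller than any given positive number infinitely often. -/
lemma IsMean.infinite_setOf_sum_sub_lt (hm : IsMean m) (hfin : ∀ A : Set X, A.Finite → m A = 0)
    {ι : Type*} [Fintype ι] (σ : ι → Equiv.Perm X) (hσ : ∀ i A, m (σ i '' A) = m A)
    (φ : ι → X → ℝ) (B : ℝ) (hB : ∀ i x, |φ i x| ≤ B) {u : ℝ} (hu : 0 < u) :
    {x | ∑ i, (φ i (σ i x) - φ i x) < u}.Infinite := by
  classical
  intro hbad
  obtain ⟨K, hK⟩ := exists_nat_gt ((Fintype.card ι : ℝ) / u)
  rw [div_lt_iff₀ hu] at hK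
  obtain ⟨M, hM⟩ := exists_nat_gt (K * B + 1)
  let I := Finset.Icc (-(M : ℤ)) M
  have hmem (i : ι) (x : X) : ⌊K * φ i x⌋ ∈ I := by
    have h1 := abs_le.1 (hB i x)
    have h2 : (K : ℝ) * φ i x ≤ K * B := by gcongr; exact h1.2
    have h3 : (K : ℝ) * (-B) ≤ K * φ i x := by gcongr; exact h1.1
    rw [Finset.mem_Icc]
    constructor
    · rw [Int.le_floor]; push_cast; linarith
    · have := Int.floor_le (K * φ i x)
      have h4 : ((⌊K * φ i x⌋ : ℤ) : ℝ) ≤ ((M : ℤ) : ℝ) := by push_cast; linarith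
      exact_mod_cast h4
  let ψ (i : ι) (x : X) : I := ⟨⌊K * φ i x⌋, hmem i x⟩
  let Φ (x : X) : ι → I × I := fun i => (ψ i (σ i x), ψ i x)
  let v (k : I) : ℝ := ((k : ℤ) : ℝ)
  have hzero : ∑ t, m (Φ ⁻¹' {t}) * ∑ i, (v (t i).1 - v (t i).2) = 0 := by
    simp_rw [Finset.mul_sum]
    rw [Finset.sum_comm]
    refine Finset.sum_eq_zero fun i _ => ?_
    simp_rw [mul_sub]
    rw [Finset.sum_sub_distrib, hm.sum_comp Φ (fun t => (t i).1) v,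
      hm.sum_comp Φ (fun t => (t i).2) v, sub_eq_zero]
    refine Finset.sum_congr rfl fun k _ => ?_
    congr 1
    rw [← hσ i]
    congr 1
    ext x
    rw [Equiv.image_eq_preimage_symm]
    simp [Φ]
  have hone : ∑ t, m (Φ ⁻¹' {t}) = 1 := by
    rw [← hm.preimage_finset]
    simpa using hm.1
  have hle (t : ι → I × I) : m (Φ ⁻¹' {t}) * (K * u - Fintype.card ι) ≤
      m (Φ ⁻¹' {t}) * ∑ i, (v (t i).1 - v (t i).2) := by
    by_cases hx : ∃ x ∈ Φ ⁻¹' {t}, u ≤ ∑ i, (φ i (σ i x) - φ i x)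
    · obtain ⟨x, rfl, hx⟩ := hx
      refine mul_le_mul_of_nonneg_left ?_ (hm.2.1 _)
      have h1 : ∑ i, ((K : ℝ) * (φ i (σ i x) - φ i x) - 1) ≤
          ∑ i, (v (Φ x i).1 - v (Φ x i).2) := by
        refine Finset.sum_le_sum fun i _ => ?_
        have h2 := Int.lt_floor_add_one ((K : ℝ) * φ i (σ i x))
        have h3 := Int.floor_le ((K : ℝ) * φ i x)
        simp only [v, Φ, ψ]
        linarith
      rw [Finset.sum_sub_distrib, ← Finset.mul_sum] at h1
      simp only [Finset.sum_const, Finset.card_univ, nsmul_eq_mul, mul_one] at h1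
      have h4 : (K : ℝ) * u ≤ K * ∑ i, (φ i (σ i x) - φ i x) := by gcongr
      linarith
    · push Not at hx
      rw [hfin _ (hbad.subset hx)]
      simp
  have := Finset.sum_le_sum fun t (_ : t ∈ Finset.univ) => hle t
  rw [hzero, ← Finset.sum_mul, hone] at this
  linarith

end Mean

section AlmostInvariant

variable {X ι : Type*} [Fintype ι]

/-- The map `f ↦ (σ i • f - f)ᵢ` from finitely supported functions to `ℓ¹`. -/
noncomputable def coboundary [DecidableEq X] [DecidableEq ι] (σ : ι → Equiv.Perm X) :
    (X →₀ ℝ) →ₗ[ℝ] lp (fun _ : ι × X => ℝ) 1 :=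
  Finsupp.linearCombination ℝ fun x =>
    ∑ i, (lp.single 1 (i, σ i x) (1 : ℝ) - lp.single 1 (i, x) (1 : ℝ))

lemma coboundary_apply [DecidableEq X] [DecidableEq ι] (σ : ι → Equiv.Perm X) (f : X →₀ ℝ)
    (j : ι) (y : X) : coboundary σ f (j, y) = f ((σ j).symm y) - f y := by
  induction f using Finsupp.induction_linear with
  | zero => simp
  | add f g hf hg =>
    rw [map_add, lp.coeFn_add, Pi.add_apply, hf, hg]
    simp only [Finsupp.add_apply]
    ring
  | single x a =>
    simp only [coboundary, Finsupp.linearCombination_single, lp.coeFn_smul, Pi.smul_apply,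
      lp.coeFn_sum, Finset.sum_apply, lp.coeFn_sub, Pi.sub_apply, lp.single_apply, smul_eq_mul,
      Pi.single_apply, Prod.mk.injEq, Finsupp.single_apply, ite_and, Finset.sum_sub_distrib,
      Finset.sum_ite_eq, Finset.mem_univ, if_true]
    simp only [Equiv.eq_symm_apply, eq_comm (a := y)]
    split_ifs <;> simp

/-- If no bounded coboundary is eventually bounded below by a positive number, then there are
finitely supported probability vectors with small entries that are almost invariant in `ℓ¹`. -/
lemma exists_almost_invariant_finsupp (σ : ι → Equiv.Perm X)
    (hσ : ∀ (φ : ι → X → ℝ) (B : ℝ), (∀ i x, |φ i x| ≤ B) → ∀ u : ℝ, 0 < u →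
      {x | ∑ i, (φ i (σ i x) - φ i x) < u}.Infinite)
    {δ ε : ℝ} (hδ : 0 < δ) (hε : 0 < ε) :
    ∃ f : X →₀ ℝ, (∀ x, 0 ≤ f x ∧ f x ≤ δ) ∧ (∑ x ∈ f.support, f x = 1) ∧
      ∀ S : Finset X, ∑ i, ∑ y ∈ S, |f ((σ i).symm y) - f y| < ε := by
  classical
  let C : Set (X →₀ ℝ) :=
    {f | (∀ x, 0 ≤ f x ∧ f x ≤ δ) ∧ Finsupp.linearCombination ℝ (fun _ => (1 : ℝ)) f = 1}
  have hC : Convex ℝ C := by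
    rintro f ⟨hf, hf1⟩ g ⟨hg, hg1⟩ a b ha hb hab
    refine ⟨fun x => ?_, ?_⟩
    · simp only [Finsupp.add_apply, Finsupp.smul_apply, smul_eq_mul]
      have h1 := mul_nonneg ha (hf x).1
      have h2 := mul_nonneg hb (hg x).1
      have h3 := mul_le_mul_of_nonneg_left (hf x).2 ha
      have h4 := mul_le_mul_of_nonneg_left (hg x).2 hb
      refine ⟨by linarith, ?_⟩
      calc _ ≤ a * δ + b * δ := by linarith
        _ = δ := by rw [← add_mul, hab, one_mul]
    · rw [map_add, map_smul, map_smul, hf1, hg1]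
      simpa using hab
  suffices h : ∃ f ∈ C, ‖coboundary σ f‖ < ε by
    obtain ⟨f, ⟨hf, hf1⟩, hfε⟩ := h
    refine ⟨f, hf, ?_, fun S => lt_of_le_of_lt ?_ hfε⟩
    · simpa [Finsupp.linearCombination_apply, Finsupp.sum] using hf1
    · have := lp.sum_rpow_le_norm_rpow (p := 1) (by simp) (coboundary σ f) (Finset.univ ×ˢ S)
      simpa [Finset.sum_product, coboundary_apply] using this
  by_contra! hcon
  obtain ⟨ψ, u, hψ, hψu⟩ := geometric_hahn_banach_open (convex_ball 0 ε) Metric.isOpen_ball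
    (hC.linear_image (coboundary σ)) (by
      rw [Set.disjoint_left]
      rintro _ hb ⟨f, hf, rfl⟩
      rw [mem_ball_zero_iff] at hb
      exact absurd hb (not_lt.2 (hcon f hf)))
  have hu : 0 < u := by simpa using hψ 0 (by simpa using hε)
  have hinf := hσ (fun i x => ψ (lp.single 1 (i, x) (1 : ℝ))) ‖ψ‖ (fun i x => by
    refine (ψ.le_opNorm _).trans ?_
    rw [lp.norm_single (by simp)]
    simp) u hu
  obtain ⟨N, hN⟩ := exists_nat_gt (1 / δ)
  have hN0 : (0 : ℝ) < N := (one_div_pos.2 hδ).trans hN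
  obtain ⟨A, hA, hAN⟩ := hinf.exists_subset_card_eq N
  let f : X →₀ ℝ := ∑ x ∈ A, Finsupp.single x (N : ℝ)⁻¹
  have hfx (y : X) : f y = if y ∈ A then (N : ℝ)⁻¹ else 0 := by
    simp [f, Finsupp.finsetSum_apply, Finsupp.single_apply]
  have hfC : f ∈ C := by
    refine ⟨fun x => ?_, ?_⟩
    · rw [hfx]
      have : (N : ℝ)⁻¹ ≤ δ := by
        rw [inv_le_comm₀ hN0 hδ, ← one_div]
        exact hN.le
      split_ifs
      · exact ⟨by positivity, this⟩
      · exact ⟨le_rfl, hδ.le⟩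
    · simp [f, map_sum, hAN, hN0.ne']
  have h1 := hψu _ ⟨f, hfC, rfl⟩
  have h2 : ψ (coboundary σ f) < u := by
    have hA0 : A.Nonempty := by
      rw [← Finset.card_pos, hAN]; exact_mod_cast hN0
    have h3 : ψ (coboundary σ f) = ∑ x ∈ A, (N : ℝ)⁻¹ *
        ∑ i, (ψ (lp.single 1 (i, σ i x) (1 : ℝ)) - ψ (lp.single 1 (i, x) (1 : ℝ))) := by
      simp only [f, map_sum, coboundary, Finsupp.linearCombination_single, map_smul, map_sub,
        smul_eq_mul]
    rw [h3]
    calc _ < ∑ x ∈ A, (N : ℝ)⁻¹ * u := by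
          refine Finset.sum_lt_sum_of_nonempty hA0 fun x hx => ?_
          exact mul_lt_mul_of_pos_left (hA hx) (by positivity)
      _ = u := by
          rw [Finset.sum_const, hAN, nsmul_eq_mul]
          field_simp
  linarith

end AlmostInvariant

section LevelSets

lemma antitone_ite_lt (a : ℝ) : Antitone fun t : ℝ => if t < a then (1 : ℝ) else 0 := by
  intro s t hst
  dsimp only
  split_ifs with h1 h2
  · exact le_rfl
  · exact absurd (hst.trans_lt h1) h2
  · exact zero_le_one
  · exact le_rfl

lemma intervalIntegrable_ite_lt (a b c : ℝ) :
    IntervalIntegrable (fun t : ℝ => if t < a then (1 : ℝ) else 0) MeasureTheory.volume b c :=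
  (antitone_ite_lt a).intervalIntegrable

lemma integral_ite_lt {a δ : ℝ} (h0 : 0 ≤ a) (h1 : a ≤ δ) :
    ∫ t in (0 : ℝ)..δ, (if t < a then (1 : ℝ) else 0) = a := by
  rw [← intervalIntegral.integral_add_adjacent_intervals (intervalIntegrable_ite_lt a 0 a)
    (intervalIntegrable_ite_lt a a δ)]
  have e1 : ∫ t in (0 : ℝ)..a, (if t < a then (1 : ℝ) else 0) = ∫ t in (0 : ℝ)..a, (1 : ℝ) := by
    refine intervalIntegral.integral_congr_ae ?_
    filter_upwards [MeasureTheory.Measure.ae_ne MeasureTheory.volume a] with t ht hta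
    rw [Set.uIoc_of_le h0] at hta
    rw [if_pos (lt_of_le_of_ne hta.2 ht)]
  have e2 : ∫ t in a..δ, (if t < a then (1 : ℝ) else 0) = ∫ t in a..δ, (0 : ℝ) := by
    refine intervalIntegral.integral_congr fun t ht => ?_
    rw [Set.uIcc_of_le h1] at ht
    exact if_neg (not_lt.2 ht.1)
  simp [e1, e2]

lemma abs_ite_lt_sub_ite_lt (a b t : ℝ) :
    |(if t < a then (1 : ℝ) else 0) - (if t < b then 1 else 0)| =
      (if t < max a b then 1 else 0) - (if t < min a b then 1 else 0) := by
  simp only [lt_max_iff, lt_min_iff]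
  by_cases ha : t < a <;> by_cases hb : t < b <;> simp [ha, hb]

lemma intervalIntegrable_abs_ite_lt_sub (a b c d : ℝ) :
    IntervalIntegrable (fun t : ℝ => |(if t < a then (1 : ℝ) else 0) - (if t < b then 1 else 0)|)
      MeasureTheory.volume c d :=
  ((intervalIntegrable_ite_lt a c d).sub (intervalIntegrable_ite_lt b c d)).abs

lemma integral_abs_ite_lt_sub {a b δ : ℝ} (ha : 0 ≤ a) (haδ : a ≤ δ) (hb : 0 ≤ b) (hbδ : b ≤ δ) :
    ∫ t in (0 : ℝ)..δ, |(if t < a then (1 : ℝ) else 0) - (if t < b then 1 else 0)| = |a - b| := by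
  simp_rw [abs_ite_lt_sub_ite_lt]
  rw [intervalIntegral.integral_sub (intervalIntegrable_ite_lt _ _ _)
    (intervalIntegrable_ite_lt _ _ _), integral_ite_lt (ha.trans (le_max_left a b))
    (max_le haδ hbδ), integral_ite_lt (le_min ha hb) ((min_le_left a b).trans haδ),
    max_sub_min_eq_abs']

/-- Some level set of an almost invariant probability vector with small entries is large and
almost invariant. -/
lemma exists_finset_of_almost_invariant_finsupp {X ι : Type*} [DecidableEq X] [Fintype ι]
    (σ : ι → Equiv.Perm X) {ε : ℝ} (hε : 0 < ε) (n : ℕ) {δ : ℝ} (hδ : 0 ≤ δ)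
    (hδn : δ * n ≤ 1 / 2) (f : X →₀ ℝ)
    (hf : ∀ x, 0 ≤ f x ∧ f x ≤ δ) (hf1 : ∑ x ∈ f.support, f x = 1)
    (hinv : ∀ S : Finset X, ∑ i, ∑ y ∈ S, |f ((σ i).symm y) - f y| < ε / 2) :
    ∃ W : Finset X, n ≤ W.card ∧
      ∀ i, ((symmDiff (W.image (σ i)) W).card : ℝ) < ε * W.card := by
  by_contra! hcon
  let S : Finset X := f.support ∪ Finset.univ.biUnion fun i => f.support.image (σ i)
  let χ (t : ℝ) (x : X) : ℝ := if t < f x then 1 else 0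
  let W (t : ℝ) : Finset X := f.support.filter fun x => t < f x
  have hmemW {t : ℝ} (ht : 0 ≤ t) (x : X) : x ∈ W t ↔ t < f x := by
    simp only [W, Finset.mem_filter, Finsupp.mem_support_iff, and_iff_right_iff_imp]
    intro h
    exact (ht.trans_lt h).ne'
  have hcard (t : ℝ) : ((W t).card : ℝ) = ∑ x ∈ f.support, χ t x := by
    simp [W, χ]
  have hsd {t : ℝ} (ht : 0 ≤ t) (i : ι) :
      ((symmDiff ((W t).image (σ i)) (W t)).card : ℝ) =
        ∑ y ∈ S, |χ t ((σ i).symm y) - χ t y| := by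
    have himage (y : X) : y ∈ (W t).image (σ i) ↔ t < f ((σ i).symm y) := by
      rw [← hmemW ht, Finset.mem_image]
      constructor
      · rintro ⟨x, hx, rfl⟩
        simpa using hx
      · exact fun h => ⟨_, h, by simp⟩
    have hsub : symmDiff ((W t).image (σ i)) (W t) ⊆ S := by
      intro y hy
      rw [Finset.mem_symmDiff] at hy
      simp only [S, Finset.mem_union, Finset.mem_biUnion, Finset.mem_univ, true_and]
      rcases hy with ⟨h, -⟩ | ⟨h, -⟩
      · exact Or.inr ⟨i, Finset.image_subset_image (Finset.filter_subset _ _) h⟩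
      · exact Or.inl (Finset.filter_subset _ _ h)
    rw [← Finset.sum_subset hsub (f := fun y => |χ t ((σ i).symm y) - χ t y|)]
    · rw [Finset.card_eq_sum_ones, Nat.cast_sum]
      refine Finset.sum_congr rfl fun y hy => ?_
      rw [Finset.mem_symmDiff, himage, hmemW ht] at hy
      rcases hy with ⟨h1, h2⟩ | ⟨h1, h2⟩ <;> simp [χ, h1, h2]
    · intro y _ hy
      rw [Finset.mem_symmDiff, himage, hmemW ht] at hy
      by_cases h1 : t < f ((σ i).symm y) <;> by_cases h2 : t < f y <;>
        simp [h1, h2, χ] at hy ⊢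
  have hpt (t : ℝ) (ht : t ∈ Set.Icc 0 δ) : ε * ∑ x ∈ f.support, χ t x ≤
      (∑ i, ∑ y ∈ S, |χ t ((σ i).symm y) - χ t y|) + ε * n := by
    rw [← hcard]
    have hnn : 0 ≤ ∑ i, ∑ y ∈ S, |χ t ((σ i).symm y) - χ t y| :=
      Finset.sum_nonneg fun i _ => Finset.sum_nonneg fun y _ => abs_nonneg _
    rcases le_or_gt n (W t).card with h | h
    · obtain ⟨i, hi⟩ := hcon _ h
      rw [hsd ht.1] at hi
      have := Finset.single_le_sum (f := fun i => ∑ y ∈ S, |χ t ((σ i).symm y) - χ t y|)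
        (fun i _ => Finset.sum_nonneg fun y _ => abs_nonneg _) (Finset.mem_univ i)
      have h0 : 0 ≤ ε * n := by positivity
      linarith
    · have : ((W t).card : ℝ) ≤ n := by exact_mod_cast h.le
      have := mul_le_mul_of_nonneg_left this hε.le
      linarith
  have hint1 : IntervalIntegrable (fun t => ∑ x ∈ f.support, χ t x) MeasureTheory.volume 0 δ := by
    simpa only [Finset.sum_fn] using
      IntervalIntegrable.sum f.support fun x _ => intervalIntegrable_ite_lt (f x) 0 δ
  have hint2 (i : ι) : IntervalIntegrable (fun t => ∑ y ∈ S, |χ t ((σ i).symm y) - χ t y|)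
      MeasureTheory.volume 0 δ := by
    simpa only [Finset.sum_fn] using IntervalIntegrable.sum S fun y _ =>
      intervalIntegrable_abs_ite_lt_sub (f ((σ i).symm y)) (f y) 0 δ
  have hint3 : IntervalIntegrable (fun t => ∑ i, ∑ y ∈ S, |χ t ((σ i).symm y) - χ t y|)
      MeasureTheory.volume 0 δ := by
    simpa only [Finset.sum_fn] using IntervalIntegrable.sum Finset.univ fun i _ => hint2 i
  have hmono := intervalIntegral.integral_mono_on hδ (hint1.const_mul ε)
    (hint3.add intervalIntegrable_const) hpt
  rw [intervalIntegral.integral_const_mul, intervalIntegral.integral_add hint3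
    intervalIntegrable_const, intervalIntegral.integral_finsetSum fun x _ =>
    intervalIntegrable_ite_lt (f x) 0 δ, intervalIntegral.integral_finsetSum fun i _ =>
    hint2 i] at hmono
  have e1 : ∑ x ∈ f.support, ∫ t in (0 : ℝ)..δ, χ t x = 1 := by
    rw [← hf1]
    exact Finset.sum_congr rfl fun x _ => integral_ite_lt (hf x).1 (hf x).2
  have e2 (i : ι) : ∫ t in (0 : ℝ)..δ, ∑ y ∈ S, |χ t ((σ i).symm y) - χ t y| =
      ∑ y ∈ S, |f ((σ i).symm y) - f y| := by
    rw [intervalIntegral.integral_finsetSum fun y _ =>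
      intervalIntegrable_abs_ite_lt_sub (f ((σ i).symm y)) (f y) 0 δ]
    exact Finset.sum_congr rfl fun y _ =>
      integral_abs_ite_lt_sub (hf _).1 (hf _).2 (hf _).1 (hf _).2
  rw [e1] at hmono
  simp only [e2, intervalIntegral.integral_const, smul_eq_mul, sub_zero] at hmono
  have := hinv S
  have := mul_le_mul_of_nonneg_left hδn hε.le
  linarith

end LevelSets

/-- A net of finite sets of unbounded size that is asymptotically invariant under conjugation
yields an atomless invariant mean, as a limit of normalized counting measures. -/
lemma innerAmenable_of_finset {G : Type*} [Group G] [DecidableEq G]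
    (h : ∀ (F : Finset G) (ε : ℝ), 0 < ε → ∀ n : ℕ, ∃ W : Finset G, n ≤ W.card ∧
      ∀ s ∈ F, ((symmDiff (W.image fun w => s * w * s⁻¹) W).card : ℝ) < ε * W.card) :
    InnerAmenable G := by
  classical
  choose W hW hWinv using fun p : Finset G × ℕ =>
    h p.1 (1 / ((p.2 : ℝ) + 1)) (by positivity) (p.2 + 1)
  have hpos (p : Finset G × ℕ) : (0 : ℝ) < (W p).card := by
    have := hW p
    exact_mod_cast (by omega : 0 < (W p).card)
  let a (p : Finset G × ℕ) (A : Set G) : ℝ := ((W p).filter (· ∈ A)).card / (W p).card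
  have ha0 (p A) : 0 ≤ a p A := by positivity
  have ha1 (p A) : a p A ≤ 1 := by
    refine (div_le_one (hpos p)).2 ?_
    exact_mod_cast Finset.card_filter_le _ _
  let U : Ultrafilter (Finset G × ℕ) := Ultrafilter.of atTop
  have hU : (U : Filter (Finset G × ℕ)) ≤ atTop := Ultrafilter.of_le _
  have hk : Tendsto (fun p : Finset G × ℕ => 1 / ((p.2 : ℝ) + 1)) U (𝓝 0) :=
    (tendsto_one_div_add_atTop_nhds_zero_nat.comp tendsto_snd).comp
      (prod_atTop_atTop_eq (α := Finset G) (β := ℕ) ▸ hU)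
  have hlim (A : Set G) : ∃ l, Tendsto (fun p => a p A) U (𝓝 l) := by
    obtain ⟨l, -, hl⟩ := (isCompact_Icc (a := (0 : ℝ)) (b := 1)).ultrafilter_le_nhds
      (U.map fun p => a p A) (by
        rw [le_principal_iff]
        exact Filter.mem_map.2 (Filter.univ_mem' fun p => ⟨ha0 p A, ha1 p A⟩))
    exact ⟨l, hl⟩
  choose m hm using hlim
  refine ⟨m, ⟨?_, fun A => ?_, fun A B hAB => ?_⟩, fun A hA => ?_, fun g A => ?_⟩
  · refine tendsto_nhds_unique (hm _) (tendsto_const_nhds.congr fun p => ?_)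
    simp [a, (hpos p).ne']
  · exact ge_of_tendsto' (hm A) fun p => ha0 p A
  · refine tendsto_nhds_unique (hm _) (((hm A).add (hm B)).congr fun p => ?_)
    simp only [a]
    rw [← add_div, ← Nat.cast_add, ← Finset.card_union_of_disjoint, ← Finset.filter_or]
    · simp only [Set.mem_union]
    · rw [Finset.disjoint_filter]
      exact fun x _ hxA hxB => Set.disjoint_left.1 hAB hxA hxB
  · refine tendsto_nhds_unique (hm A) (squeeze_zero (fun p => ha0 p A) (fun p => ?_)
      (by simpa using hk.const_mul (hA.toFinset.card : ℝ)))
    simp only [a]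
    rw [← div_eq_mul_inv]
    have hc : ((W p).filter (· ∈ A)).card ≤ hA.toFinset.card :=
      Finset.card_le_card fun x hx => by simpa using (Finset.mem_filter.1 hx).2
    gcongr
    exact_mod_cast hW p
  · rw [← sub_eq_zero]
    refine tendsto_nhds_unique ((hm _).sub (hm A)) (squeeze_zero_norm' ?_ hk)
    have hev : ∀ᶠ p : Finset G × ℕ in U, g⁻¹ ∈ p.1 := by
      refine hU (mem_of_superset (mem_atTop (({g⁻¹} : Finset G), 0)) fun p hp => ?_)
      exact hp.1 (Finset.mem_singleton_self _)
    filter_upwards [hev] with p hp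
    have hinv := hWinv p _ hp
    set V := (W p).image fun w => g⁻¹ * w * g⁻¹⁻¹ with hV
    have hcard : ((W p).filter (· ∈ (fun h => g * h * g⁻¹) '' A)).card =
        (V.filter (· ∈ A)).card := by
      refine Finset.card_bij (fun x _ => g⁻¹ * x * g⁻¹⁻¹) ?_ ?_ ?_
      · intro x hx
        rw [Finset.mem_filter] at hx ⊢
        obtain ⟨hxW, y, hy, rfl⟩ := hx
        refine ⟨Finset.mem_image_of_mem _ hxW, ?_⟩
        simpa [mul_assoc] using hy
      · intro x _ y _ hxy
        simpa using hxy
      · intro y hy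
        obtain ⟨hyV, hyA⟩ := Finset.mem_filter.1 hy
        obtain ⟨x, hx, rfl⟩ := Finset.mem_image.1 hyV
        exact ⟨x, Finset.mem_filter.2 ⟨hx, _, hyA, by simp [mul_assoc]⟩, rfl⟩
    have hle (P Q : Finset G) : ((P.filter (· ∈ A)).card : ℝ) ≤
        (Q.filter (· ∈ A)).card + (symmDiff P Q).card := by
      rw [← Nat.cast_add, Nat.cast_le]
      refine (Finset.card_le_card fun x hx => ?_).trans (Finset.card_union_le _ _)
      rw [Finset.mem_filter] at hx
      by_cases hxQ : x ∈ Q <;> simp [hx.1, hx.2, hxQ, Finset.mem_symmDiff]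
    have h1 := hle V (W p)
    have h2 := hle (W p) V
    rw [symmDiff_comm] at h2
    simp only [a]
    rw [hcard, ← sub_div, Real.norm_eq_abs, abs_div, abs_of_pos (hpos p), div_le_iff₀ (hpos p),
      abs_le]
    constructor <;> linarith

/-- A countable discrete group `G` is inner amenable if and only if for every finite
`F ⊆ G`, `ε > 0`, and `n ∈ ℕ` there is a finite `W ⊆ G` with `|W| ≥ n` and
`|sWs⁻¹ Δ W| < ε|W|` for all `s ∈ F`. -/
theorem stmt16 {G : Type*} [Group G] [Countable G] [DecidableEq G] :
    InnerAmenable G ↔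
      ∀ (F : Finset G) (ε : ℝ), 0 < ε → ∀ n : ℕ, ∃ W : Finset G, n ≤ W.card ∧
        ∀ s ∈ F, ((symmDiff (W.image fun w => s * w * s⁻¹) W).card : ℝ) < ε * W.card := by
  refine ⟨?_, innerAmenable_of_finset⟩
  rintro ⟨m, hm, hfin, hinv⟩ F ε hε n
  let σ (s : F) : Equiv.Perm G := (MulAut.conj (s : G)).toEquiv
  have hδ : (0 : ℝ) < 1 / (2 * ((n : ℝ) + 1)) := by positivity
  obtain ⟨f, hf, hf1, hfε⟩ := exists_almost_invariant_finsupp σ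
    (fun φ B hB u hu => hm.infinite_setOf_sum_sub_lt hfin σ (fun s A => hinv s A) φ B hB hu)
    hδ (half_pos hε)
  obtain ⟨W, hW, hWF⟩ := exists_finset_of_almost_invariant_finsupp σ hε n hδ.le
    (by rw [div_mul_eq_mul_div, div_le_div_iff₀ (by positivity) two_pos]; linarith) f hf hf1 hfε
  exact ⟨W, hW, fun s hs => hWF ⟨s, hs⟩⟩
end

section
/- Let Γ be a finitely generated group and let n ≥ 2. Then for every subshift X ⊆ {0,…,n−1}^Γ on which the shift action of Γ is free and minimal, there are at most countably many subshifts Y ⊆ {0,…,n−1}^Γ on which the shift action of Γ is free and minimal and such that the action Γ ↷ Y is continuously orbit equivalent to Γ ↷ X. -/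
/-- The left shift action of `Γ` on `Γ → A`: `(s • x) t = x (s⁻¹ t)`. -/
def shiftAct {Γ A : Type*} [Group Γ] (s : Γ) (x : Γ → A) : Γ → A :=
  fun t => x (s⁻¹ * t)

/-- A subshift: a closed shift-invariant subset of `Γ → A`. -/
def IsSubshift {Γ A : Type*} [Group Γ] [TopologicalSpace A] (Y : Set (Γ → A)) : Prop :=
  IsClosed Y ∧ ∀ s : Γ, ∀ x ∈ Y, shiftAct s x ∈ Y

/-- The shift action on `Y` is free. -/
def ShiftFree {Γ A : Type*} [Group Γ] (Y : Set (Γ → A)) : Prop :=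
  ∀ s : Γ, ∀ x ∈ Y, shiftAct s x = x → s = 1

/-- The shift action on `Y` is minimal: every orbit is dense in `Y`. -/
def ShiftMinimal {Γ A : Type*} [Group Γ] [TopologicalSpace A] (Y : Set (Γ → A)) : Prop :=
  ∀ x ∈ Y, Y ⊆ closure (Set.range fun s : Γ => shiftAct s x)

/-- `f` is locally constant on `S`. -/
def LocConstOn {A B : Type*} [TopologicalSpace A] (f : A → B) (S : Set A) : Prop :=
  ∀ x ∈ S, ∃ U : Set A, IsOpen U ∧ x ∈ U ∧ ∀ z ∈ U ∩ S, f z = f x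

/-- The shift actions of `Γ` on the subsets `X` and `Y` of `Γ → A` are continuously orbit
equivalent: there is a homeomorphism `Φ : X → Y` with continuous orbit cocycles. -/
def ContOrbitEquiv {Γ A : Type*} [Group Γ] [TopologicalSpace A]
    (X Y : Set (Γ → A)) : Prop :=
  ∃ (Φ Ψ : (Γ → A) → (Γ → A)) (κ lam : Γ → (Γ → A) → Γ),
    ContinuousOn Φ X ∧ ContinuousOn Ψ Y ∧ Set.MapsTo Φ X Y ∧ Set.MapsTo Ψ Y X ∧
    (∀ x ∈ X, Ψ (Φ x) = x) ∧ (∀ y ∈ Y, Φ (Ψ y) = y) ∧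
    (∀ g : Γ, LocConstOn (κ g) X) ∧ (∀ h : Γ, LocConstOn (lam h) Y) ∧
    (∀ g : Γ, ∀ x ∈ X, Φ (shiftAct g x) = shiftAct (κ g x) (Φ x)) ∧
    (∀ h : Γ, ∀ y ∈ Y, Ψ (shiftAct h y) = shiftAct (lam h y) (Ψ y))

section ShiftAct

variable {Γ A : Type*} [Group Γ]

theorem shiftAct_one (x : Γ → A) : shiftAct 1 x = x := by
  funext t
  simp [shiftAct]

theorem shiftAct_mul (g h : Γ) (x : Γ → A) :
    shiftAct (g * h) x = shiftAct g (shiftAct h x) := by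
  funext t
  simp [shiftAct, mul_assoc]

theorem ShiftFree.eq_of_shiftAct_eq {Y : Set (Γ → A)} (hY : ShiftFree Y) {y : Γ → A}
    (hy : y ∈ Y) {g h : Γ} (hgh : shiftAct g y = shiftAct h y) : g = h := by
  have : shiftAct (h⁻¹ * g) y = y := by
    rw [shiftAct_mul, hgh, ← shiftAct_mul, inv_mul_cancel, shiftAct_one]
  exact (inv_mul_eq_one.mp (hY _ y hy this)).symm

/-- An orbit map into a free subshift satisfies the cocycle identity. -/
theorem ShiftFree.cocycle_mul {X Y : Set (Γ → A)} (hY : ShiftFree Y)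
    (hX : ∀ s : Γ, ∀ x ∈ X, shiftAct s x ∈ X)
    {Φ : (Γ → A) → (Γ → A)} {κ : Γ → (Γ → A) → Γ} (hΦ : Set.MapsTo Φ X Y)
    (hκ : ∀ g : Γ, ∀ x ∈ X, Φ (shiftAct g x) = shiftAct (κ g x) (Φ x))
    (g h : Γ) {x : Γ → A} (hx : x ∈ X) :
    κ (g * h) x = κ g (shiftAct h x) * κ h x := by
  refine hY.eq_of_shiftAct_eq (hΦ hx) ?_
  rw [← hκ _ x hx, shiftAct_mul, hκ g _ (hX h x hx), hκ h x hx, shiftAct_mul]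

theorem ShiftFree.cocycle_one {X Y : Set (Γ → A)} (hY : ShiftFree Y)
    {Φ : (Γ → A) → (Γ → A)} {κ : Γ → (Γ → A) → Γ} (hΦ : Set.MapsTo Φ X Y)
    (hκ : ∀ g : Γ, ∀ x ∈ X, Φ (shiftAct g x) = shiftAct (κ g x) (Φ x))
    {x : Γ → A} (hx : x ∈ X) : κ 1 x = 1 := by
  refine hY _ _ (hΦ hx) ?_
  rw [← hκ _ x hx, shiftAct_one]

/-- Orbit cocycles into free subshifts are determined by their values on generators. -/
theorem cocycle_eq_of_eq_on_generators {X Y Y' : Set (Γ → A)} (hY : ShiftFree Y)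
    (hY' : ShiftFree Y') (hX : ∀ s : Γ, ∀ x ∈ X, shiftAct s x ∈ X)
    {Φ Φ' : (Γ → A) → (Γ → A)} {κ κ' : Γ → (Γ → A) → Γ}
    (hΦ : Set.MapsTo Φ X Y) (hΦ' : Set.MapsTo Φ' X Y')
    (hκ : ∀ g : Γ, ∀ x ∈ X, Φ (shiftAct g x) = shiftAct (κ g x) (Φ x))
    (hκ' : ∀ g : Γ, ∀ x ∈ X, Φ' (shiftAct g x) = shiftAct (κ' g x) (Φ' x))
    {S : Set Γ} (hS : Subgroup.closure S = ⊤)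
    (heq : ∀ s ∈ S, ∀ x ∈ X, κ s x = κ' s x) (g : Γ) :
    ∀ x ∈ X, κ g x = κ' g x := by
  have hg : g ∈ Subgroup.closure S := hS ▸ Subgroup.mem_top g
  induction hg using Subgroup.closure_induction with
  | mem s hs => exact heq s hs
  | one =>
    intro x hx
    rw [hY.cocycle_one hΦ hκ hx, hY'.cocycle_one hΦ' hκ' hx]
  | mul a b _ _ iha ihb =>
    intro x hx
    rw [hY.cocycle_mul hX hΦ hκ a b hx, hY'.cocycle_mul hX hΦ' hκ' a b hx,
      iha _ (hX b x hx), ihb x hx]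
  | inv a _ ih =>
    intro x hx
    have h := hY.cocycle_mul hX hΦ hκ a a⁻¹ hx
    have hinv := hY'.cocycle_mul hX hΦ' hκ' a a⁻¹ hx
    rw [mul_inv_cancel, hY.cocycle_one hΦ hκ hx, ih _ (hX _ x hx)] at h
    rw [mul_inv_cancel, hY'.cocycle_one hΦ' hκ' hx] at hinv
    exact mul_left_cancel (h.symm.trans hinv)

/-- An orbit map whose cocycle is onto at each point is determined by its cocycle and its
coordinate at the identity. -/
theorem orbitMap_eq_of_cocycle_eq {X : Set (Γ → A)}
    (hX : ∀ s : Γ, ∀ x ∈ X, shiftAct s x ∈ X)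
    {Φ Φ' : (Γ → A) → (Γ → A)} {κ κ' : Γ → (Γ → A) → Γ}
    (hκ : ∀ g : Γ, ∀ x ∈ X, Φ (shiftAct g x) = shiftAct (κ g x) (Φ x))
    (hκ' : ∀ g : Γ, ∀ x ∈ X, Φ' (shiftAct g x) = shiftAct (κ' g x) (Φ' x))
    (hsurj : ∀ x ∈ X, Function.Surjective fun g => κ g x)
    (heq : ∀ g : Γ, ∀ x ∈ X, κ g x = κ' g x)
    (hone : ∀ x ∈ X, Φ x 1 = Φ' x 1) : Set.EqOn Φ Φ' X := by
  intro x hx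
  funext t
  obtain ⟨g, hg⟩ := hsurj x hx t⁻¹
  have h := hone _ (hX g x hx)
  rw [hκ g x hx, hκ' g x hx, ← heq g x hx, show κ g x = t⁻¹ from hg] at h
  simpa [shiftAct] using h

theorem ShiftFree.cocycle_surjective {X Y : Set (Γ → A)} (hY : ShiftFree Y)
    (hYinv : ∀ s : Γ, ∀ y ∈ Y, shiftAct s y ∈ Y)
    {Φ Ψ : (Γ → A) → (Γ → A)} {κ lam : Γ → (Γ → A) → Γ} (hΦ : Set.MapsTo Φ X Y)
    (hΨΦ : ∀ x ∈ X, Ψ (Φ x) = x) (hΦΨ : ∀ y ∈ Y, Φ (Ψ y) = y)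
    (hκ : ∀ g : Γ, ∀ x ∈ X, Φ (shiftAct g x) = shiftAct (κ g x) (Φ x))
    (hlam : ∀ h : Γ, ∀ y ∈ Y, Ψ (shiftAct h y) = shiftAct (lam h y) (Ψ y))
    {x : Γ → A} (hx : x ∈ X) : Function.Surjective fun g => κ g x := by
  intro h
  refine ⟨lam h (Φ x), hY.eq_of_shiftAct_eq (hΦ hx) ?_⟩
  have hΨ := hlam h (Φ x) (hΦ hx)
  rw [hΨΦ x hx] at hΨ
  rw [← hκ _ x hx, ← hΨ, hΦΨ _ (hYinv h _ (hΦ hx))]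

end ShiftAct

theorem Group.FG.countable_of_fg {G : Type*} [Group G] (hG : Group.FG G) : Countable G := by
  obtain ⟨S, hS, φ, hφ⟩ := Group.fg_iff_exists_freeGroup_hom_surjective.mp hG
  have : Countable S := hS.countable.to_subtype
  have : Countable (FreeGroup S) := Quot.mk_surjective.countable
  exact hφ.countable

theorem LocConstOn.isLocallyConstant {A B : Type*} [TopologicalSpace A] {f : A → B} {S : Set A}
    (hf : LocConstOn f S) : IsLocallyConstant (S.domRestrict f) := by
  rw [IsLocallyConstant.iff_exists_open]
  rintro ⟨x, hx⟩
  obtain ⟨U, hU, hxU, hfU⟩ := hf x hx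
  exact ⟨Subtype.val ⁻¹' U, hU.preimage continuous_subtype_val, hxU,
    fun z hz => hfU z ⟨hz, z.2⟩⟩

/-- There are only countably many locally constant functions from a compact second countable
Hausdorff totally disconnected space to a countable set. -/
theorem LocallyConstant.countable_of_compact {Z D : Type*} [TopologicalSpace Z] [CompactSpace Z]
    [T2Space Z] [TotallyDisconnectedSpace Z] [SecondCountableTopology Z] [Countable D] :
    Countable (LocallyConstant Z D) := by
  have : Countable (TopologicalSpace.Clopens Z) :=
    TopologicalSpace.Clopens.countable_iff_secondCountable.mpr inferInstance
  let graph (f : LocallyConstant Z D) : Set (TopologicalSpace.Clopens Z × D) :=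
    (fun d => (⟨f ⁻¹' {d}, f.isLocallyConstant.isClopen_fiber d⟩, d)) '' Set.range f
  have hfin (f : LocallyConstant Z D) : (graph f).Finite := f.range_finite.image _
  refine Function.Injective.countable (f := fun f => (hfin f).toFinset) fun f f' h => ?_
  have h : graph f = graph f' := by simpa using h
  ext z
  have hz : (⟨f ⁻¹' {f z}, f.isLocallyConstant.isClopen_fiber _⟩, f z) ∈ graph f :=
    ⟨f z, ⟨z, rfl⟩, rfl⟩
  rw [h] at hz
  obtain ⟨d, -, hd⟩ := hz
  obtain ⟨hset, rfl⟩ := Prod.mk.inj hd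
  have hset := congrArg (fun C : TopologicalSpace.Clopens Z => (C : Set Z)) hset
  have : z ∈ f' ⁻¹' {f z} := by
    change f' ⁻¹' {f z} = f ⁻¹' {f z} at hset
    rw [hset]
    rfl
  exact this.symm

/-- For a finitely generated group `Γ` and `n ≥ 2`, any free minimal subshift
`X ⊆ {0, …, n-1}^Γ` is continuously orbit equivalent to at most countably many free
minimal subshifts `Y ⊆ {0, …, n-1}^Γ`. -/
theorem stmt17 {Γ : Type*} [Group Γ] (hFG : Group.FG Γ) (n : ℕ) (hn : 2 ≤ n)
    (X : Set (Γ → Fin n)) (hX : IsSubshift X ∧ ShiftFree X ∧ ShiftMinimal X) :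
    {Y : Set (Γ → Fin n) |
      IsSubshift Y ∧ ShiftFree Y ∧ ShiftMinimal Y ∧ ContOrbitEquiv X Y}.Countable := by
  obtain ⟨⟨hXc, hXinv⟩, -⟩ := hX
  obtain ⟨S, hS⟩ := Group.fg_def.mp hFG
  have : Countable Γ := hFG.countable_of_fg
  have : CompactSpace X := isCompact_iff_compactSpace.mp hXc.isCompact
  have : Countable (LocallyConstant X (Fin n)) := LocallyConstant.countable_of_compact
  have : Countable (LocallyConstant X Γ) := LocallyConstant.countable_of_compact
  have key (Y : {Y : Set (Γ → Fin n) |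
      IsSubshift Y ∧ ShiftFree Y ∧ ShiftMinimal Y ∧ ContOrbitEquiv X Y}) :
      ∃ (d : LocallyConstant X (Fin n) × (S → LocallyConstant X Γ))
        (Φ : (Γ → Fin n) → (Γ → Fin n)) (κ : Γ → (Γ → Fin n) → Γ),
        Set.MapsTo Φ X Y ∧ Φ '' X = Y ∧
        (∀ g : Γ, ∀ x ∈ X, Φ (shiftAct g x) = shiftAct (κ g x) (Φ x)) ∧
        (∀ x ∈ X, Function.Surjective fun g => κ g x) ∧
        (∀ x : X, d.1 x = Φ x 1) ∧ ∀ (s : S) (x : X), d.2 s x = κ s x := by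
    obtain ⟨Y, ⟨-, hYinv⟩, hYf, -, Φ, Ψ, κ, lam, hΦc, -, hΦ, hΨ, hΨΦ, hΦΨ, hκc, -, hκ, hlam⟩ := Y
    have hcont : Continuous fun x : X => Φ x 1 :=
      (continuous_apply 1).comp hΦc.domRestrict
    refine ⟨(⟨fun x => Φ x 1, (IsLocallyConstant.iff_continuous _).mpr hcont⟩,
      fun s => ⟨X.domRestrict (κ s), (hκc s).isLocallyConstant⟩), Φ, κ, hΦ, ?_, hκ,
      fun x hx => hYf.cocycle_surjective hYinv hΦ hΨΦ hΦΨ hκ hlam hx,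
      fun _ => rfl, fun _ _ => rfl⟩
    exact hΦ.image_subset.antisymm fun y hy => ⟨Ψ y, hΨ hy, hΦΨ y hy⟩
  choose d Φ κ hΦ himg hκ hsurj hd₁ hd₂ using key
  refine Set.countable_coe_iff.mp (Function.Injective.countable (f := d) fun Y Y' h => ?_)
  have hκeq : ∀ g, ∀ x ∈ X, κ Y g x = κ Y' g x :=
    cocycle_eq_of_eq_on_generators Y.2.2.1 Y'.2.2.1 hXinv (hΦ Y) (hΦ Y') (hκ Y) (hκ Y') hS
      fun s hs x hx => by
        rw [← hd₂ Y ⟨s, hs⟩ ⟨x, hx⟩, ← hd₂ Y' ⟨s, hs⟩ ⟨x, hx⟩, h]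
  have hΦeq := orbitMap_eq_of_cocycle_eq hXinv (hκ Y) (hκ Y') (hsurj Y) hκeq
    fun x hx => by rw [← hd₁ Y ⟨x, hx⟩, ← hd₁ Y' ⟨x, hx⟩, h]
  exact Subtype.ext (by rw [← himg Y, ← himg Y', hΦeq.image_eq])
end

section
/- Let H be a countable group. Then the following are equivalent: (a) there exist sequences (c_n)_{n∈ℕ} and (d_n)_{n∈ℕ} in H, each asymptotically central in H, with c_n d_n ≠ d_n c_n for all n; (b) for every finite subset F ⊆ H the centralizer C_H(F) is non-Abelian. Moreover, if (c_n) and (d_n) are asymptotically central sequences in H with c_n d_n ≠ d_n c_n for all n, then both sequences are nontrivial, i.e., {c_n : n ∈ ℕ} and {d_n : n ∈ ℕ} are infinite. -/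
/-- A sequence `(c n)` in a group `H` is asymptotically central if every `h ∈ H` commutes
with all but finitely many of the `c n`. -/
def AsympCentral {H : Type*} [Group H] (c : ℕ → H) : Prop :=
  ∀ h : H, {n : ℕ | ¬ h * c n = c n * h}.Finite

theorem AsympCentral.infinite_range_of_not_commute {H : Type*} [Group H] {c d : ℕ → H}
    (hd : AsympCentral d) (hcd : ∀ n, c n * d n ≠ d n * c n) : (Set.range c).Infinite := by
  intro hfin
  refine Set.infinite_univ ((hfin.biUnion fun h _ => hd h).subset fun n _ => ?_)
  exact Set.mem_biUnion (Set.mem_range_self n) (hcd n)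

theorem asympCentral_of_forall_commute {H : Type*} [Group H] {e c : ℕ → H}
    (he : Function.Surjective e) (hc : ∀ n, ∀ k < n, e k * c n = c n * e k) :
    AsympCentral c := by
  intro h
  obtain ⟨k, rfl⟩ := he h
  refine (Set.finite_Iic k).subset fun n hn => ?_
  by_contra hkn
  exact hn (hc n k (not_le.mp hkn))

theorem AsympCentral.exists_forall_mem_commute {H : Type*} [Group H] {c d : ℕ → H}
    (hc : AsympCentral c) (hd : AsympCentral d) (F : Finset H) :
    ∃ n, (∀ f ∈ F, f * c n = c n * f) ∧ ∀ f ∈ F, f * d n = d n * f := by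
  have hfin := F.finite_toSet.biUnion fun h _ => (hc h).union (hd h)
  obtain ⟨n, hn⟩ := hfin.exists_notMem
  simp only [Set.mem_iUnion, not_exists, Set.mem_union, Set.mem_ofPred_eq, not_or, not_not] at hn
  exact ⟨n, fun f hf => (hn f hf).1, fun f hf => (hn f hf).2⟩

/-- In a countable group `H`: there exist two noncommuting asymptotically central sequences
if and only if the centralizer of every finite subset is non-Abelian; moreover any two
noncommuting asymptotically central sequences are both nontrivial. -/
theorem stmt18 {H : Type*} [Group H] [Countable H] :
    ((∃ c d : ℕ → H, AsympCentral c ∧ AsympCentral d ∧ ∀ n, c n * d n ≠ d n * c n) ↔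
      ∀ F : Finset H, ∃ x y : H, (∀ f ∈ F, f * x = x * f) ∧ (∀ f ∈ F, f * y = y * f) ∧
        x * y ≠ y * x) ∧
    ∀ c d : ℕ → H, AsympCentral c → AsympCentral d → (∀ n, c n * d n ≠ d n * c n) →
      (Set.range c).Infinite ∧ (Set.range d).Infinite := by
  classical
  refine ⟨⟨?_, fun hF => ?_⟩, fun c d hc hd hcd =>
    ⟨hd.infinite_range_of_not_commute hcd,
      hc.infinite_range_of_not_commute fun n => (hcd n).symm⟩⟩
  · rintro ⟨c, d, hc, hd, hcd⟩ F
    obtain ⟨n, hcn, hdn⟩ := hc.exists_forall_mem_commute hd F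
    exact ⟨c n, d n, hcn, hdn, hcd n⟩
  · obtain ⟨e, he⟩ := exists_surjective_nat H
    choose c d hc hd hcd using fun n : ℕ => hF ((Finset.range n).image e)
    refine ⟨c, d, asympCentral_of_forall_commute he fun n k hk => hc n _ ?_,
      asympCentral_of_forall_commute he fun n k hk => hd n _ ?_, hcd⟩ <;>
    exact Finset.mem_image_of_mem e (Finset.mem_range.mpr hk)
end

section
/- Let G be a countable discrete group, let G ↷ (X,μ) and G ↷ (Y,ν) be measure-preserving actions on standard probability spaces, and let π : Y → X be a G-equivariant measure-preserving map. Suppose (ν_x)_{x∈X} is a measurable family of Borel probability measures on Y disintegrating ν over π, i.e., ν_x(π^{-1}(x)) = 1 for μ-a.e. x, ν(B) = ∫_X ν_x(B) dμ(x) for every measurable B ⊆ Y, and g_*ν_x = ν_{gx} for all g ∈ G and μ-a.e. x ∈ X. Assume: (a) there exist a G-invariant μ-conull Borel set X' ⊆ X and an increasing sequence 𝒮₀ ⊆ 𝒮₁ ⊆ ⋯ of Borel equivalence relations on X', each with all equivalence classes finite, whose union is the orbit equivalence relation of G on X'; and (b) for μ-a.e. x ∈ X the action of the stabilizer subgroup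 G_x = {g ∈ G : gx = x} on (π^{-1}(x), ν_x) admits a stability sequence. Then the action G ↷ (Y,ν) admits a stability sequence. -/
open MeasureTheory Filter

/-- A stability sequence for a measure-preserving action `act` of a countable group `G` on
`(Y, ν)` (Jones–Schmidt): a sequence `(Tₙ, Aₙ)` with `Tₙ : Y → G` measurable such that
`Tₙ⁰ : y ↦ act (Tₙ y) y` is a `ν`-preserving automorphism, satisfying asymptotic
equivariance, asymptotic triviality on sets, asymptotic invariance of `Aₙ`, and
`ν(Tₙ⁰(Aₙ) Δ Aₙ) ≥ 1/2`. -/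
def HasStabilitySeq {G Y : Type*} [Group G] [MeasurableSpace Y]
    (ν : Measure Y) (act : G → Y → Y) : Prop :=
  ∃ (T : ℕ → Y → G) (A : ℕ → Set Y),
    (∀ (n : ℕ) (g : G), MeasurableSet {y | T n y = g}) ∧
    (∀ n, MeasurableSet (A n)) ∧
    (∀ n, MeasurePreserving (fun y => act (T n y) y) ν ν) ∧
    (∀ n, ∃ Sinv : Y → Y, Measurable Sinv ∧
      (∀ᵐ y ∂ν, Sinv (act (T n y) y) = y) ∧
      (∀ᵐ y ∂ν, act (T n (Sinv y)) (Sinv y) = y)) ∧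
    (∀ g : G, Tendsto (fun n => ν {y | T n (act g y) = g * T n y * g⁻¹}) atTop
      (nhds 1)) ∧
    (∀ B : Set Y, MeasurableSet B →
      Tendsto (fun n => ν (symmDiff ((fun y => act (T n y) y) '' B) B)) atTop (nhds 0)) ∧
    (∀ g : G, Tendsto (fun n => ν (symmDiff (act g '' A n) (A n))) atTop (nhds 0)) ∧
    (∀ n : ℕ, 1 / 2 ≤ ν (symmDiff ((fun y => act (T n y) y) '' A n) (A n)))

/-- Countable measurable selection. -/
theorem exists_measurable_mem_of_countable {X Z : Type*} [MeasurableSpace X] [MeasurableSpace Z]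
    [Countable Z] [Nonempty Z] {P : Z → Set X} (hP : ∀ z, MeasurableSet (P z)) :
    ∃ h : X → Z, Measurable h ∧ ∀ x, (∃ z, x ∈ P z) → x ∈ P (h x) := by
  classical
  obtain ⟨e, he⟩ := exists_surjective_nat Z
  have hex : ∀ x, ∃ n, (x ∈ P (e n) ∨ ∀ z, x ∉ P z) := by
    intro x
    by_cases hx : ∃ z, x ∈ P z
    · obtain ⟨z, hz⟩ := hx
      obtain ⟨n, rfl⟩ := he z
      exact ⟨n, Or.inl hz⟩
    · exact ⟨0, Or.inr (by simpa using hx)⟩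
  refine ⟨fun x => e (Nat.find (hex x)), ?_, ?_⟩
  · refine measurable_from_nat.comp (measurable_find hex fun n => ?_)
    have : {x | x ∈ P (e n) ∨ ∀ z, x ∉ P z} = P (e n) ∪ ⋂ z, (P z)ᶜ := by
      ext x; simp
    rw [this]
    exact (hP _).union (.iInter fun z => (hP z).compl)
  · rintro x ⟨z, hz⟩
    exact (Nat.find_spec (hex x)).resolve_right fun h => h z hz

theorem isCompact_box (b : ℕ → ℕ) : IsCompact {c : ℕ → ℕ | ∀ i, c i ≤ b i} := by
  have := isCompact_univ_pi (fun i => (Set.finite_Iic (b i)).isCompact)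
  convert this using 1
  ext c
  simp [Pi.le_def]

/-- A neighbourhood of a compact box in Baire space contains a box constrained in finitely many
coordinates only. -/
theorem exists_box_subset_of_isOpen {b : ℕ → ℕ} {V : Set (ℕ → ℕ)} (hV : IsOpen V)
    (hbV : {c : ℕ → ℕ | ∀ i, c i ≤ b i} ⊆ V) :
    ∃ k, {c : ℕ → ℕ | ∀ i < k, c i ≤ b i} ⊆ V := by
  have hK := isCompact_box b
  by_contra! hcon
  simp only [Set.not_subset] at hcon
  choose c hc hcV using hcon
  obtain ⟨d, hd, φ, hφ, hlim⟩ := hK.tendsto_subseq (x := fun k i => min (c k i) (b i))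
    (fun k i => min_le_right _ _)
  have hlim' : Tendsto (fun k => c (φ k)) atTop (nhds d) := by
    rw [tendsto_pi_nhds] at hlim ⊢
    intro i
    refine (hlim i).congr' ?_
    filter_upwards [hφ.tendsto_atTop.eventually_gt_atTop i] with k hk
    exact min_eq_left (hc (φ k) i hk)
  obtain ⟨k, hk⟩ := (hlim'.eventually (hV.mem_nhds (hbV hd))).exists
  exact hcV _ hk

/-- Images of Baire space under continuous maps can be approximated in outer measure from inside
by images of compact sets. -/
theorem exists_isCompact_lt_measure_image {X : Type*} [TopologicalSpace X] [MeasurableSpace X]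
    (μ : Measure X) [μ.OuterRegular] {p : (ℕ → ℕ) → X} (hp : Continuous p)
    {r : ENNReal} (hr : r < μ (Set.range p)) :
    ∃ K, IsCompact K ∧ r ≤ μ (p '' K) := by
  have step : ∀ (C : Set (ℕ → ℕ)) (k : ℕ), r < μ (p '' C) →
      ∃ n, r < μ (p '' (C ∩ {c | c k ≤ n})) := by
    intro C k hC
    have hU : p '' C = ⋃ n, p '' (C ∩ {c | c k ≤ n}) := by
      rw [← Set.image_iUnion, ← Set.inter_iUnion]
      congr 1
      refine (Set.inter_eq_left.2 fun c _ => ?_).symm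
      simp only [Set.mem_iUnion]
      exact ⟨c k, le_refl (c k)⟩
    have hmono : Monotone fun n => p '' (C ∩ {c | c k ≤ n}) := by
      intro m n hmn
      refine Set.image_mono (Set.inter_subset_inter_right _ fun c hc => ?_)
      exact le_trans hc hmn
    rw [hU, hmono.measure_iUnion] at hC
    exact lt_iSup_iff.1 hC
  have main : ∃ C : ℕ → {C : Set (ℕ → ℕ) // r < μ (p '' C)}, ∃ b : ℕ → ℕ,
      ∀ k, (C (k + 1)).1 = (C k).1 ∩ {c | c k ≤ b k} := by
    let b : {C : Set (ℕ → ℕ) // r < μ (p '' C)} → ℕ → ℕ := fun C k => (step C.1 k C.2).choose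
    let C : ℕ → {C : Set (ℕ → ℕ) // r < μ (p '' C)} := fun k =>
      Nat.rec ⟨Set.univ, by rwa [Set.image_univ]⟩
        (fun k C => ⟨C.1 ∩ {c | c k ≤ b C k}, (step C.1 k C.2).choose_spec⟩) k
    exact ⟨C, fun k => b (C k) k, fun k => rfl⟩
  obtain ⟨C, b, hC⟩ := main
  have hCsub : ∀ k, (C k).1 ⊆ {c | ∀ i < k, c i ≤ b i} := by
    intro k
    induction k with
    | zero => intro c _ i hi; omega
    | succ k ih =>
      rw [hC]
      rintro c ⟨h1, h2⟩ i hi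
      rcases Nat.lt_succ_iff_lt_or_eq.1 hi with h | rfl
      · exact ih h1 i h
      · exact h2
  refine ⟨{c | ∀ i, c i ≤ b i}, ?_, ?_⟩
  · exact isCompact_box b
  · by_contra! hlt
    obtain ⟨O, hO, hOo, hOr⟩ := Set.exists_isOpen_lt_of_lt _ _ hlt
    obtain ⟨k, hk⟩ := exists_box_subset_of_isOpen (hOo.preimage hp) (Set.image_subset_iff.1 hO)
    have h1 : p '' (C k).1 ⊆ O := Set.image_subset_iff.2 ((hCsub k).trans hk)
    exact absurd ((C k).2.trans_le (measure_mono h1)) (not_lt.2 hOr.le)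

/-- A continuous map from Baire space has a measurable section over the image of each
compact set. -/
theorem exists_measurable_section_of_isCompact {X : Type*} [TopologicalSpace X] [T2Space X]
    [MeasurableSpace X] [OpensMeasurableSpace X] {p : (ℕ → ℕ) → X} (hp : Continuous p)
    {K : Set (ℕ → ℕ)} (hK : IsCompact K) :
    ∃ s : X → ℕ → ℕ, Measurable s ∧ ∀ x ∈ p '' K, p (s x) = x := by
  have step : ∀ (n : ℕ) (g : {g : X → ℕ → ℕ // Measurable g ∧
      ∀ x ∈ p '' K, ∃ c ∈ K, p c = x ∧ ∀ i < n, c i = g x i}),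
      ∃ g' : {g : X → ℕ → ℕ // Measurable g ∧
        ∀ x ∈ p '' K, ∃ c ∈ K, p c = x ∧ ∀ i < n + 1, c i = g x i},
        ∀ x, ∀ i < n, g'.1 x i = g.1 x i := by
    rintro n ⟨g, hg, hgK⟩
    have hP : ∀ k, MeasurableSet
        {x | ∃ c ∈ K, p c = x ∧ (∀ i < n, c i = g x i) ∧ c n = k} := by
      intro k
      have : {x | ∃ c ∈ K, p c = x ∧ (∀ i < n, c i = g x i) ∧ c n = k} =
          ⋃ l : Fin n → ℕ, {x | ∀ i : Fin n, g x i = l i} ∩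
            p '' (K ∩ {c | (∀ i : Fin n, c i = l i) ∧ c n = k}) := by
        ext x
        simp only [Set.mem_ofPred_eq, Set.mem_iUnion, Set.mem_inter_iff, Set.mem_image]
        constructor
        · rintro ⟨c, hc, rfl, h1, h2⟩
          exact ⟨fun i => g (p c) i, fun i => rfl, c, ⟨hc, fun i => h1 i i.2, h2⟩, rfl⟩
        · rintro ⟨l, hl, c, ⟨hc, h1, h2⟩, rfl⟩
          exact ⟨c, hc, rfl, fun i hi => (h1 ⟨i, hi⟩).trans (hl ⟨i, hi⟩).symm, h2⟩
      rw [this]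
      refine .iUnion fun l => .inter ?_ ?_
      · rw [Set.ofPred_forall]
        exact .iInter fun i => ((measurable_pi_apply _).comp hg) (measurableSet_singleton (l i))
      · refine ((hK.inter_right ?_).image hp).measurableSet
        rw [Set.ofPred_and, Set.ofPred_forall]
        exact (isClosed_iInter fun i => isClosed_eq (continuous_apply _) continuous_const).inter
          (isClosed_eq (continuous_apply _) continuous_const)
    obtain ⟨h, hh, hhP⟩ := exists_measurable_mem_of_countable hP
    refine ⟨⟨fun x => Function.update (g x) n (h x), ?_, ?_⟩, ?_⟩
    · rw [measurable_pi_iff]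
      intro i
      by_cases hi : i = n
      · subst hi; simpa using hh
      · simp only [Function.update_of_ne hi]
        exact (measurable_pi_apply i).comp hg
    · intro x hx
      obtain ⟨c, hc, hcx, hcg⟩ := hgK x hx
      obtain ⟨c, hc, hcx, hcg, hcn⟩ := hhP x ⟨c n, c, hc, hcx, hcg, rfl⟩
      refine ⟨c, hc, hcx, fun i hi => ?_⟩
      rcases Nat.lt_succ_iff_lt_or_eq.1 hi with h | rfl
      · exact (hcg i h).trans (Function.update_of_ne h.ne _ _).symm
      · simpa using hcn
    · intro x i hi
      exact Function.update_of_ne hi.ne _ _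
  choose next hnext using step
  let g : ∀ n, {g : X → ℕ → ℕ // Measurable g ∧
      ∀ x ∈ p '' K, ∃ c ∈ K, p c = x ∧ ∀ i < n, c i = g x i} := fun n =>
    Nat.rec ⟨fun _ _ => 0, measurable_const, by
      rintro _ ⟨c, hc, rfl⟩; exact ⟨c, hc, rfl, fun i hi => absurd hi (Nat.not_lt_zero i)⟩⟩
      (fun n g => next n g) n
  have hg : ∀ n x, ∀ i < n, (g (n + 1)).1 x i = (g n).1 x i := fun n x i hi => hnext n (g n) x i hi
  have hg' : ∀ n x, ∀ i < n, (g n).1 x i = (g (i + 1)).1 x i := by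
    intro n x i hi
    induction n with
    | zero => omega
    | succ n ih =>
      rcases Nat.lt_succ_iff_lt_or_eq.1 hi with h | rfl
      · rw [hg n x i h, ih h]
      · rfl
  refine ⟨fun x i => (g (i + 1)).1 x i, ?_, ?_⟩
  · rw [measurable_pi_iff]
    exact fun i => (measurable_pi_apply i).comp (g (i + 1)).2.1
  · intro x hx
    choose c hcK hcx hcg using fun n => (g n).2.2 x hx
    have hlim : Tendsto c atTop (nhds fun i => (g (i + 1)).1 x i) := by
      rw [tendsto_pi_nhds]
      intro i
      refine tendsto_const_nhds.congr' ?_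
      filter_upwards [eventually_gt_atTop i] with n hn
      rw [hcg n i hn, hg' n x i hn]
    exact tendsto_nhds_unique ((hp.tendsto _).comp hlim)
      (tendsto_const_nhds.congr fun n => (hcx n).symm)

/-- Jankov–von Neumann selection modulo null sets. -/
theorem exists_measurable_selection_ae {X Ω : Type*} [MeasurableSpace X] [StandardBorelSpace X]
    [MeasurableSpace Ω] [StandardBorelSpace Ω] (μ : Measure X) [IsFiniteMeasure μ]
    {P : Set (X × Ω)} (hP : MeasurableSet P) (hex : ∀ᵐ x ∂μ, ∃ c, (x, c) ∈ P) [Nonempty Ω] :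
    ∃ f : X → Ω, Measurable f ∧ ∀ᵐ x ∂μ, (x, f x) ∈ P := by
  let _ := upgradeStandardBorel X
  let _ := upgradeStandardBorel Ω
  have hPa : AnalyticSet P := hP.analyticSet
  rw [AnalyticSet] at hPa
  obtain hempty | ⟨F, hF, hFP⟩ := hPa
  · refine ⟨fun _ => Classical.arbitrary Ω, measurable_const, ?_⟩
    filter_upwards [hex] with x ⟨c, hc⟩
    simp [hempty] at hc
  set p : (ℕ → ℕ) → X := fun c => (F c).1 with hp_def
  have hp : Continuous p := continuous_fst.comp hF
  have hrange : ∀ᵐ x ∂μ, x ∈ Set.range p := by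
    filter_upwards [hex] with x ⟨c, hc⟩
    rw [← hFP] at hc
    obtain ⟨d, hd⟩ := hc
    exact ⟨d, by simp [hp_def, hd]⟩
  suffices h : ∃ s : X → ℕ → ℕ, Measurable s ∧ ∀ᵐ x ∂μ, p (s x) = x by
    obtain ⟨s, hs, hsp⟩ := h
    refine ⟨fun x => (F (s x)).2, (continuous_snd.comp hF).measurable.comp hs, ?_⟩
    filter_upwards [hsp] with x hx
    rw [← hFP]
    exact ⟨s x, Prod.ext hx rfl⟩
  rcases eq_or_ne (μ Set.univ) 0 with hμ | hμ
  · exact ⟨fun _ _ => 0, measurable_const, by simp [Measure.measure_univ_eq_zero.1 hμ]⟩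
  have huniv : μ (Set.range p) = μ Set.univ := measure_congr (eventuallyEq_univ.2 hrange)
  obtain ⟨r, -, hr, hrlim⟩ := exists_seq_strictMono_tendsto' (pos_iff_ne_zero.2 hμ)
  choose K hK hrK using fun n => exists_isCompact_lt_measure_image μ hp
    (show r n < μ (Set.range p) from huniv ▸ (hr n).2)
  choose s hs hsp using fun n => exists_measurable_section_of_isCompact hp (hK n)
  have hpK : ∀ n, MeasurableSet (p '' K n) := fun n => ((hK n).image hp).measurableSet
  obtain ⟨j, hj, hjP⟩ := exists_measurable_mem_of_countable hpK
  refine ⟨fun x => s (j x) x, ?_, ?_⟩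
  · have : Measurable fun q : ℕ × X => s q.1 q.2 := measurable_from_prod_countable_right hs
    exact this.comp (hj.prodMk measurable_id)
  · have hfull : ∀ᵐ x ∂μ, x ∈ ⋃ n, p '' K n := by
      refine (ae_iff_measure_eq (p := fun x => x ∈ ⋃ n, p '' K n)
        (MeasurableSet.iUnion hpK).nullMeasurableSet).2 ?_
      refine le_antisymm (measure_mono (Set.subset_univ _)) ?_
      refine le_of_tendsto hrlim (Eventually.of_forall fun n => ?_)
      exact (hrK n).trans (measure_mono (Set.subset_iUnion (fun n => p '' K n) n))
    filter_upwards [hfull] with x hx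
    exact hsp _ x (hjP x (Set.mem_iUnion.1 hx))

/-- A standard Borel space has a sequence of measurable sets which is dense in the measure algebra
of every finite measure. -/
theorem exists_seq_measurableSet_dense (Y : Type*) [MeasurableSpace Y]
    [MeasurableSpace.CountablyGenerated Y] :
    ∃ B : ℕ → Set Y, (∀ j, MeasurableSet (B j)) ∧
      ∀ (κ : Measure Y) [IsFiniteMeasure κ] (E : Set Y), MeasurableSet E →
        ∀ ε : ENNReal, ε ≠ 0 → ∃ j, κ (symmDiff E (B j)) < ε := by
  set 𝒜 := generateSetAlgebra (MeasurableSpace.countableGeneratingSet Y) with h𝒜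
  have hc : 𝒜.Countable :=
    countable_generateSetAlgebra MeasurableSpace.countable_countableGeneratingSet
  have halg : IsSetAlgebra 𝒜 := isSetAlgebra_generateSetAlgebra
  have hgen : ‹MeasurableSpace Y› = MeasurableSpace.generateFrom 𝒜 := by
    rw [h𝒜, generateFrom_generateSetAlgebra_eq,
      MeasurableSpace.generateFrom_countableGeneratingSet]
  obtain ⟨B, hB⟩ := hc.exists_eq_range ⟨∅, halg.empty_mem⟩
  refine ⟨B, fun j => ?_, fun κ _ E hE ε hε => ?_⟩
  · rw [hgen]
    exact MeasurableSpace.measurableSet_generateFrom (hB ▸ Set.mem_range_self j)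
  · obtain ⟨δ, hδ, hδε⟩ : ∃ δ : ℝ, 0 < δ ∧ ENNReal.ofReal δ ≤ ε := by
      rcases eq_or_ne ε ⊤ with rfl | h
      · exact ⟨1, one_pos, le_top⟩
      · exact ⟨ε.toReal, ENNReal.toReal_pos hε h, (ENNReal.ofReal_toReal h).le⟩
    obtain ⟨t, ht, hlt⟩ := (Measure.MeasureDense.of_generateFrom_isSetAlgebra_finite
      (μ := κ) halg hgen).approx E hE (measure_ne_top _ _) δ hδ
    obtain ⟨j, rfl⟩ := hB ▸ ht
    exact ⟨j, hlt.trans_le hδε⟩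

/-- A measurable map parametrized by a standard Borel space which realizes all measurable maps
from `Y` to a countable space, modulo null sets for an arbitrary finite measure. -/
theorem exists_universal_measurable (Y Z : Type*) [MeasurableSpace Y]
    [MeasurableSpace.CountablyGenerated Y] [MeasurableSpace Z] [MeasurableSingletonClass Z]
    [Countable Z] [Nonempty Z] :
    ∃ Φ : (Z → ℕ → ℕ) × Y → Z, Measurable Φ ∧
      ∀ (κ : Measure Y) [IsFiniteMeasure κ] (F : Y → Z), Measurable F →
        ∃ c, ∀ᵐ y ∂κ, Φ (c, y) = F y := by
  obtain ⟨B, hB, hdense⟩ := exists_seq_measurableSet_dense Y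
  have hP : ∀ z : Z, MeasurableSet
      {q : (Z → ℕ → ℕ) × Y | ∃ᶠ i in atTop, q.2 ∈ B (q.1 z i)} := by
    intro z
    have hi : ∀ i, MeasurableSet {q : (Z → ℕ → ℕ) × Y | q.2 ∈ B (q.1 z i)} := by
      intro i
      have : {q : (Z → ℕ → ℕ) × Y | q.2 ∈ B (q.1 z i)} =
          ⋃ k, {q : (Z → ℕ → ℕ) × Y | q.1 z i = k} ∩ {q | q.2 ∈ B k} := by
        ext q; simp
      rw [this]
      refine .iUnion fun k => .inter ?_ (measurable_snd (hB k))
      have : Measurable fun q : (Z → ℕ → ℕ) × Y => q.1 z i :=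
        (measurable_pi_apply i).comp ((measurable_pi_apply z).comp measurable_fst)
      exact this (measurableSet_singleton k)
    convert MeasurableSet.measurableSet_limsup hi using 1
    ext q
    simp [mem_limsup_iff_frequently_mem]
  obtain ⟨Φ, hΦ, hΦP⟩ := exists_measurable_mem_of_countable hP
  refine ⟨Φ, hΦ, fun κ _ F hF => ?_⟩
  have hε : ∑' i : ℕ, (2⁻¹ : ENNReal) ^ i ≠ ⊤ := by simp [ENNReal.tsum_geometric]
  choose c hc using fun (z : Z) (i : ℕ) => hdense κ (F ⁻¹' {z}) (hF (measurableSet_singleton z))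
    ((2⁻¹ : ENNReal) ^ i) (pow_ne_zero _ (by simp))
  have hae : ∀ᵐ y ∂κ, ∀ z, ∀ᶠ i in atTop, (y ∈ B (c z i) ↔ F y = z) := by
    rw [ae_all_iff]
    intro z
    have := ae_eventually_notMem (μ := κ) (s := fun i => symmDiff (F ⁻¹' {z}) (B (c z i)))
      (ne_top_of_le_ne_top hε (ENNReal.tsum_le_tsum fun i => (hc z i).le))
    filter_upwards [this] with y hy
    filter_upwards [hy] with i hi
    simp only [Set.mem_symmDiff, Set.mem_preimage, Set.mem_singleton_iff] at hi
    tauto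
  refine ⟨c, ?_⟩
  filter_upwards [hae] with y hy
  have h1 : ∃ᶠ i in atTop, y ∈ B (c (Φ (c, y)) i) := by
    refine hΦP (c, y) ⟨F y, ?_⟩
    exact ((hy (F y)).mono fun i hi => hi.2 rfl).frequently
  obtain ⟨i, hi, hi'⟩ := (h1.and_eventually (hy (Φ (c, y)))).exists
  exact (hi'.1 hi).symm

/-- A stability sequence for the elements of `H` acting on `(Y, κ)`, given by cocycles `T` of
automorphisms, cocycles `U` of their inverses, and asymptotically invariant sets `A`; the
asymptotic triviality is tested on translates of the sets `B j`. -/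
structure IsStabilityData {G Y : Type*} [Group G] [MulAction G Y] [MeasurableSpace Y]
    (B : ℕ → Set Y) (κ : Measure Y) (H : Set G) (T U : ℕ → Y → G) (A : ℕ → Set Y) : Prop where
  mem_fst : ∀ m, ∀ᵐ y ∂κ, T m y ∈ H
  mem_snd : ∀ m, ∀ᵐ y ∂κ, U m y ∈ H
  left_inv : ∀ m, ∀ᵐ y ∂κ, U m (T m y • y) = (T m y)⁻¹
  right_inv : ∀ m, ∀ᵐ y ∂κ, T m (U m y • y) = (U m y)⁻¹
  equivariant : ∀ g ∈ H, Tendsto (fun m => κ {y | ¬ T m (g • y) = g * T m y * g⁻¹}) atTop (nhds 0)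
  trivial : ∀ (g : G) (j : ℕ),
    Tendsto (fun m => κ {y | ¬ (g • U m y • y ∈ B j ↔ g • y ∈ B j)}) atTop (nhds 0)
  invariant : ∀ g ∈ H, Tendsto (fun m => κ {y | ¬ (g • y ∈ A m ↔ y ∈ A m)}) atTop (nhds 0)
  half_le : ∀ m, 1 / 2 ≤ κ {y | ¬ (U m y • y ∈ A m ↔ y ∈ A m)}

/-- Stability data may be modified on null sets. -/
theorem IsStabilityData.congr {G Y : Type*} [Group G] [Countable G]
    [MulAction G Y] [MeasurableSpace Y] {B : ℕ → Set Y} {κ : Measure Y} {H : Set G}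
    {T U T' U' : ℕ → Y → G} {A A' : ℕ → Set Y} (h : IsStabilityData B κ H T U A)
    (hH : ∀ g ∈ H, MeasurePreserving (fun y : Y => g • y) κ κ)
    (heq : ∀ m, ∀ᵐ y ∂κ, T m y = T' m y ∧ U m y = U' m y ∧ (y ∈ A m ↔ y ∈ A' m)) :
    IsStabilityData B κ H T' U' A' := by
  have hall : ∀ᵐ y ∂κ, ∀ g ∈ H, ∀ m, T m (g • y) = T' m (g • y) ∧ U m (g • y) = U' m (g • y) ∧
      (g • y ∈ A m ↔ g • y ∈ A' m) := by
    rw [ae_all_iff]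
    intro g
    by_cases hg : g ∈ H
    · filter_upwards [(hH g hg).quasiMeasurePreserving.ae (ae_all_iff.2 heq)] with y hy _
      exact hy
    · exact Eventually.of_forall fun y hg' => absurd hg' hg
  have hall1 : ∀ᵐ y ∂κ, ∀ m, T m y = T' m y ∧ U m y = U' m y ∧ (y ∈ A m ↔ y ∈ A' m) :=
    ae_all_iff.2 heq
  have hset : ∀ {p q : Y → Prop}, (∀ᵐ y ∂κ, p y ↔ q y) → κ {y | p y} = κ {y | q y} :=
    fun hpq => measure_congr (eventuallyEq_set.2 hpq)
  refine ⟨fun m => ?_, fun m => ?_, fun m => ?_, fun m => ?_, fun g hg => ?_, fun g j => ?_,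
    fun g hg => ?_, fun m => ?_⟩
  · filter_upwards [hall1, h.mem_fst m] with y hy hm
    rwa [← (hy m).1]
  · filter_upwards [hall1, h.mem_snd m] with y hy hm
    rwa [← (hy m).2.1]
  · filter_upwards [hall1, hall, h.mem_fst m, h.left_inv m] with y hy hy' hm hi
    rw [← (hy m).1, ← (hy' _ hm m).2.1, hi]
  · filter_upwards [hall1, hall, h.mem_snd m, h.right_inv m] with y hy hy' hm hi
    rw [← (hy m).2.1, ← (hy' _ hm m).1, hi]
  · refine (h.equivariant g hg).congr fun m => hset ?_
    filter_upwards [hall1, hall] with y hy hy'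
    rw [← (hy m).1, ← (hy' _ hg m).1]
  · refine (h.trivial g j).congr fun m => hset ?_
    filter_upwards [hall1] with y hy
    rw [← (hy m).2.1]
  · refine (h.invariant g hg).congr fun m => hset ?_
    filter_upwards [hall1, hall] with y hy hy'
    rw [← (hy m).2.2, ← (hy' _ hg m).2.2]
  · refine (h.half_le m).trans_eq (hset ?_)
    filter_upwards [hall1, hall, h.mem_snd m] with y hy hy' hm
    rw [← (hy m).2.1, ← (hy m).2.2, ← (hy' _ hm m).2.2]

/-- The parameters at which measurable fields are stability data form a measurable set. -/
theorem measurableSet_isStabilityData {G Y W : Type*} [Group G] [Countable G]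
    [MeasurableSpace G] [DiscreteMeasurableSpace G] [MeasurableSpace Y] [MulAction G Y]
    [MeasurableSMul₂ G Y] [MeasurableSpace W] {B : ℕ → Set Y} (hB : ∀ j, MeasurableSet (B j))
    (κ : ProbabilityTheory.Kernel W Y)
    [ProbabilityTheory.IsSFiniteKernel κ] {H : W → Set G} (hH : ∀ g, MeasurableSet {w | g ∈ H w})
    {T U : ℕ → W × Y → G} (hT : ∀ m, Measurable (T m)) (hU : ∀ m, Measurable (U m))
    {A : ℕ → Set (W × Y)} (hA : ∀ m, MeasurableSet (A m)) :
    MeasurableSet {w | IsStabilityData B (κ w) (H w) (fun m y => T m (w, y))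
      (fun m y => U m (w, y)) (fun m => {y | (w, y) ∈ A m})} := by
  have hκ : ∀ {p : W × Y → Prop}, Measurable p → Measurable fun w => κ w {y | p (w, y)} :=
    fun {p} hp => ProbabilityTheory.Kernel.measurable_kernel_prodMk_left
      (measurableSet_setOfPred.2 hp)
  have hae : ∀ {p : W × Y → Prop}, Measurable p →
      MeasurableSet {w | ∀ᵐ y ∂κ w, p (w, y)} := fun {p} hp =>
    (hκ hp.not) (measurableSet_singleton 0)
  have hlim : ∀ {p : ℕ → W × Y → Prop}, (∀ m, Measurable (p m)) →
      MeasurableSet {w | Tendsto (fun m => κ w {y | p m (w, y)}) atTop (nhds 0)} := fun {p} hp =>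
    measurableSet_tendsto _ fun m => hκ (hp m)
  have hmemH : ∀ {f : W × Y → G}, Measurable f → Measurable fun q => f q ∈ H q.1 := by
    intro f hf
    have : Measurable fun q : G × W => q.1 ∈ H q.2 :=
      measurable_from_prod_countable_right fun g => measurableSet_setOfPred.1 (hH g)
    exact this.comp (hf.prodMk measurable_fst)
  have hAp : ∀ m {f : W × Y → Y}, Measurable f → Measurable fun q => (q.1, f q) ∈ A m :=
    fun m f hf => (measurableSet_setOfPred.1 (hA m)).comp (measurable_fst.prodMk hf)
  have hBp : ∀ j {f : W × Y → Y}, Measurable f → Measurable fun q => f q ∈ B j :=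
    fun j f hf => (measurableSet_setOfPred.1 (hB j)).comp hf
  have heq : ∀ {f g : W × Y → G}, Measurable f → Measurable g → Measurable fun q => f q = g q :=
    fun hf hg => measurableSet_setOfPred.1 (measurableSet_eq_fun hf hg)
  have hTs : ∀ m {f : W × Y → Y}, Measurable f → Measurable fun q => T m (q.1, f q) :=
    fun m f hf => (hT m).comp (measurable_fst.prodMk hf)
  have hUs : ∀ m {f : W × Y → Y}, Measurable f → Measurable fun q => U m (q.1, f q) :=
    fun m f hf => (hU m).comp (measurable_fst.prodMk hf)
  have hconj : {w | IsStabilityData B (κ w) (H w) (fun m y => T m (w, y))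
      (fun m y => U m (w, y)) (fun m => {y | (w, y) ∈ A m})} =
      {w | ∀ m, ∀ᵐ y ∂κ w, T m (w, y) ∈ H w} ∩ ({w | ∀ m, ∀ᵐ y ∂κ w, U m (w, y) ∈ H w} ∩
      ({w | ∀ m, ∀ᵐ y ∂κ w, U m (w, T m (w, y) • y) = (T m (w, y))⁻¹} ∩
      ({w | ∀ m, ∀ᵐ y ∂κ w, T m (w, U m (w, y) • y) = (U m (w, y))⁻¹} ∩
      ({w | ∀ g : G, g ∈ H w → Tendsto (fun m => κ w {y | ¬ T m (w, g • y) = g * T m (w, y) * g⁻¹})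
        atTop (nhds 0)} ∩
      ({w | ∀ (g : G) (j : ℕ), Tendsto
        (fun m => κ w {y | ¬ (g • U m (w, y) • y ∈ B j ↔ g • y ∈ B j)}) atTop (nhds 0)} ∩
      ({w | ∀ g : G, g ∈ H w → Tendsto (fun m => κ w {y | ¬ ((w, g • y) ∈ A m ↔ (w, y) ∈ A m)})
        atTop (nhds 0)} ∩
      {w | ∀ m, 1 / 2 ≤ κ w {y | ¬ ((w, U m (w, y) • y) ∈ A m ↔ (w, y) ∈ A m)}})))))) := by
    ext w
    exact ⟨fun h => ⟨h.1, h.2, h.3, h.4, h.5, h.6, h.7, h.8⟩,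
      fun ⟨h1, h2, h3, h4, h5, h6, h7, h8⟩ => ⟨h1, h2, h3, h4, h5, h6, h7, h8⟩⟩
  have hg : ∀ g : G, Measurable fun q : W × Y => g • q.2 := fun g => measurable_snd.const_smul g
  have hTy : ∀ m, Measurable fun q : W × Y => T m q • q.2 := fun m => (hT m).smul measurable_snd
  have hUy : ∀ m, Measurable fun q : W × Y => U m q • q.2 := fun m => (hU m).smul measurable_snd
  rw [hconj]
  simp only [Set.ofPred_forall]
  refine MeasurableSet.inter (.iInter fun m => hae (hmemH (hT m))) <|
    .inter (.iInter fun m => hae (hmemH (hU m))) <|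
    .inter (.iInter fun m => hae (heq (hUs m (hTy m)) (hT m).inv)) <|
    .inter (.iInter fun m => hae (heq (hTs m (hUy m)) (hU m).inv)) <|
    .inter (.iInter fun g => ?_) <| .inter (.iInter fun g => .iInter fun j => ?_) <|
    .inter (.iInter fun g => ?_) (.iInter fun m => ?_)
  · simp only [imp_iff_not_or]
    exact .union (hH g).compl (hlim fun m =>
      (heq (hTs m (hg g)) (((hT m).const_mul g).mul_const g⁻¹)).not)
  · exact hlim (p := fun m q => ¬ (g • U m q • q.2 ∈ B j ↔ g • q.2 ∈ B j)) fun m =>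
      ((hBp j ((hUy m).const_smul g)).iff (hBp j (hg g))).not
  · simp only [imp_iff_not_or]
    exact .union (hH g).compl (hlim fun m => ((hAp m (hg g)).iff (hAp m measurable_snd)).not)
  · exact measurableSet_le measurable_const
      (hκ ((hAp m (hUy m)).iff (hAp m measurable_snd)).not)

/-- For a cocycle `T` with values in `H`, the image of a set agrees almost everywhere with its
preimage under the automorphism given by the cocycle `U` of the inverse. -/
theorem ae_mem_image_iff_of_inverse_cocycle {G Y : Type*} [Group G] [Countable G] [MulAction G Y]
    [MeasurableSpace Y] {κ : Measure Y} {H : Subgroup G}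
    (hH : ∀ g ∈ H, MeasurePreserving (fun y : Y => g • y) κ κ) {T U : Y → G}
    (hT : ∀ y, T y ∈ H) (hTU : ∀ᵐ y ∂κ, U (T y • y) = (T y)⁻¹)
    (hUT : ∀ᵐ y ∂κ, T (U y • y) = (U y)⁻¹) (B : Set Y) :
    ∀ᵐ y ∂κ, y ∈ (fun z => T z • z) '' B ↔ U y • y ∈ B := by
  have hall : ∀ᵐ y ∂κ, ∀ g ∈ H, U (T (g • y) • g • y) = (T (g • y))⁻¹ := by
    rw [ae_all_iff]
    intro g
    by_cases hg : g ∈ H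
    · filter_upwards [(hH g hg).quasiMeasurePreserving.ae hTU] with y hy _
      exact hy
    · exact Eventually.of_forall fun y hg' => absurd hg' hg
  filter_upwards [hall, hUT] with y hy hy'
  constructor
  · rintro ⟨z, hz, rfl⟩
    have := hy (T z)⁻¹ (H.inv_mem (hT z))
    simp only [inv_smul_smul] at this
    rwa [this, inv_smul_smul]
  · intro h
    refine ⟨_, h, ?_⟩
    change T (U y • y) • U y • y = y
    rw [hy', inv_smul_smul]

/-- A measurable cocycle which has an inverse cocycle defines a measure preserving map. -/
theorem measurePreserving_of_inverse_cocycle {G Y : Type*} [Group G] [Countable G]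
    [MeasurableSpace G] [DiscreteMeasurableSpace G] [MulAction G Y]
    [MeasurableSpace Y] [MeasurableSMul₂ G Y] {κ : Measure Y}
    (hG : ∀ g : G, MeasurePreserving (fun y : Y => g • y) κ κ) {T U : Y → G}
    (hT : Measurable T) (hU : Measurable U) (hTU : ∀ᵐ y ∂κ, U (T y • y) = (T y)⁻¹)
    (hUT : ∀ᵐ y ∂κ, T (U y • y) = (U y)⁻¹) :
    MeasurePreserving (fun y => T y • y) κ κ := by
  have hTm : Measurable fun y => T y • y := hT.smul measurable_id
  have hsum : ∀ {f : Y → G}, Measurable f → ∀ S, MeasurableSet S →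
      κ S = ∑' g, κ (S ∩ f ⁻¹' {g}) := by
    intro f hf S hS
    rw [← measure_iUnion]
    · congr 1
      ext y
      simp
    · intro g g' hgg'
      refine Set.disjoint_left.2 fun y hy hy' => hgg' ?_
      exact hy.2.symm.trans hy'.2
    · exact fun g => hS.inter (hf (measurableSet_singleton g))
  refine ⟨hTm, Measure.ext fun B hB => ?_⟩
  rw [Measure.map_apply hTm hB, hsum hT _ (hTm hB), hsum hU B hB,
    ← (Equiv.inv G).tsum_eq fun g => κ (B ∩ U ⁻¹' {g})]
  refine tsum_congr fun g => ?_
  rw [← (hG g).measure_preimage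
    (hB.inter (hU (measurableSet_singleton ((Equiv.inv G) g)))).nullMeasurableSet]
  refine measure_congr (eventuallyEq_set.2 ?_)
  filter_upwards [hTU, (hG g).quasiMeasurePreserving.ae hUT] with y h1 h2
  simp only [Set.mem_inter_iff, Set.mem_preimage, Set.mem_singleton_iff, Equiv.inv_apply]
  constructor
  · rintro ⟨hy, rfl⟩
    exact ⟨hy, h1⟩
  · rintro ⟨hy, h3⟩
    rw [h3, inv_smul_smul, inv_inv] at h2
    rw [h2]
    exact ⟨hy, rfl⟩

/-- A stability sequence for the action of a subgroup yields stability data. -/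
theorem HasStabilitySeq.exists_isStabilityData {G Y : Type*} [Group G] [Countable G]
    [MeasurableSpace G] [DiscreteMeasurableSpace G] [MulAction G Y]
    [MeasurableSpace Y] [MeasurableSMul₂ G Y] {κ : Measure Y} [IsProbabilityMeasure κ]
    {H : Subgroup G} (hH : ∀ g ∈ H, MeasurePreserving (fun y : Y => g • y) κ κ)
    {B : ℕ → Set Y} (hB : ∀ j, MeasurableSet (B j))
    (h : HasStabilitySeq κ (fun (g : H) (y : Y) => (g : G) • y)) :
    ∃ (T U : ℕ → Y → G) (A : ℕ → Set Y), (∀ m, Measurable (T m)) ∧ (∀ m, Measurable (U m)) ∧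
      (∀ m, MeasurableSet (A m)) ∧ IsStabilityData B κ H T U A := by
  obtain ⟨T, A, hT, hA, -, hinv, heq, htriv, hA', hhalf⟩ := h
  choose S hS hST hTS using hinv
  have hTm : ∀ m, Measurable fun y => (T m y : G) := by
    intro m
    refine measurable_to_countable' fun g => ?_
    by_cases hg : g ∈ H
    · convert hT m ⟨g, hg⟩ using 1
      ext y
      simp [Subtype.ext_iff]
    · convert MeasurableSet.empty using 1
      ext y
      simp only [Set.mem_preimage, Set.mem_singleton_iff, Set.mem_empty_iff_false, iff_false]
      rintro rfl
      exact hg (T m y).2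
  have hTU : ∀ m, ∀ᵐ y ∂κ, ((T m (S m ((T m y : G) • y)) : G))⁻¹ = (T m y : G)⁻¹ := by
    intro m
    filter_upwards [hST m] with y hy
    rw [hy]
  have hSy : ∀ m, ∀ᵐ y ∂κ, (T m (S m y) : G)⁻¹ • y = S m y := by
    intro m
    filter_upwards [hTS m] with y hy
    rw [inv_smul_eq_iff, hy]
  have hUT : ∀ m, ∀ᵐ y ∂κ, (T m ((T m (S m y) : G)⁻¹ • y) : G) = ((T m (S m y) : G)⁻¹)⁻¹ := by
    intro m
    filter_upwards [hSy m] with y hy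
    rw [hy, inv_inv]
  have himg : ∀ m (C : Set Y), κ (symmDiff ((fun y => (T m y : G) • y) '' C) C) =
      κ {y | ¬ ((T m (S m y) : G)⁻¹ • y ∈ C ↔ y ∈ C)} := by
    intro m C
    refine measure_congr (eventuallyEq_set.2 ?_)
    filter_upwards [ae_mem_image_iff_of_inverse_cocycle (T := fun y => (T m y : G)) hH
      (fun y => (T m y).2) (hTU m) (hUT m) C] with y hy
    rw [Set.mem_symmDiff, hy]
    tauto
  refine ⟨fun m y => T m y, fun m y => (T m (S m y) : G)⁻¹, A, hTm,
    fun m => ((hTm m).comp (hS m)).inv, hA, ⟨fun m => .of_forall fun y => (T m y).2,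
    fun m => .of_forall fun y => H.inv_mem (T m (S m y)).2, hTU, hUT, fun g hg => ?_,
    fun g j => ?_, fun g hg => ?_, fun m => ?_⟩⟩
  · have h1 := heq ⟨g, hg⟩
    have h2 : ∀ m, MeasurableSet {y | (T m (g • y) : G) = g * T m y * g⁻¹} := fun m =>
      measurableSet_eq_fun ((hTm m).comp (measurable_const_smul g))
        (((hTm m).const_mul g).mul_const g⁻¹)
    have h3 := ENNReal.Tendsto.sub (tendsto_const_nhds (x := (1 : ENNReal)) (f := atTop (α := ℕ)))
      h1 (Or.inl ENNReal.one_ne_top)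
    rw [tsub_self] at h3
    refine h3.congr fun m => ?_
    have h4 := prob_compl_eq_one_sub (μ := κ) (h2 m)
    rw [Set.compl_ofPred] at h4
    rw [h4]
    congr 2
    ext y
    simp [Subtype.ext_iff]
  · refine (htriv ((g • ·) ⁻¹' B j) (measurable_const_smul g (hB j))).congr fun m => ?_
    exact himg m _
  · refine (hA' (⟨g, hg⟩⁻¹)).congr fun m => congrArg κ ?_
    ext y
    have : y ∈ (fun y : Y => ((⟨g, hg⟩⁻¹ : H) : G) • y) '' A m ↔ g • y ∈ A m := by
      constructor
      · rintro ⟨z, hz, rfl⟩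
        simpa using hz
      · exact fun hy => ⟨g • y, hy, by simp⟩
    rw [Set.mem_symmDiff, this, Set.mem_ofPred_eq]
    tauto
  · exact (hhalf m).trans_eq (himg m _)

/-- Stability data for the whole group which are tested on a dense sequence of sets yield a
stability sequence. -/
theorem IsStabilityData.hasStabilitySeq {G Y : Type*} [Group G] [Countable G]
    [MeasurableSpace G] [DiscreteMeasurableSpace G] [MulAction G Y]
    [MeasurableSpace Y] [MeasurableSMul₂ G Y] {κ : Measure Y} [IsProbabilityMeasure κ]
    (hG : ∀ g : G, MeasurePreserving (fun y : Y => g • y) κ κ)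
    {B : ℕ → Set Y} (hB : ∀ j, MeasurableSet (B j))
    (hdense : ∀ E, MeasurableSet E → ∀ ε : ENNReal, ε ≠ 0 → ∃ j, κ (symmDiff E (B j)) < ε)
    {T U : ℕ → Y → G} {A : ℕ → Set Y} (hT : ∀ m, Measurable (T m)) (hU : ∀ m, Measurable (U m))
    (hA : ∀ m, MeasurableSet (A m)) (h : IsStabilityData B κ Set.univ T U A) :
    HasStabilitySeq κ (fun (g : G) (y : Y) => g • y) := by
  have himg : ∀ m (C : Set Y), κ (symmDiff ((fun y => T m y • y) '' C) C) =
      κ {y | ¬ (U m y • y ∈ C ↔ y ∈ C)} := by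
    intro m C
    refine measure_congr (eventuallyEq_set.2 ?_)
    filter_upwards [ae_mem_image_iff_of_inverse_cocycle (H := ⊤) (fun g _ => hG g)
      (fun y => Subgroup.mem_top (T m y)) (h.left_inv m) (h.right_inv m) C] with y hy
    rw [Set.mem_symmDiff, hy]
    tauto
  have hUmp := fun m =>
    measurePreserving_of_inverse_cocycle hG (hU m) (hT m) (h.right_inv m) (h.left_inv m)
  refine ⟨T, A, fun n g => hT n (measurableSet_singleton g), hA,
    fun m => measurePreserving_of_inverse_cocycle hG (hT m) (hU m) (h.left_inv m) (h.right_inv m),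
    fun m => ⟨fun y => U m y • y, (hUmp m).measurable, ?_, ?_⟩, fun g => ?_, fun E hE => ?_,
    fun g => ?_, fun m => ?_⟩
  · filter_upwards [h.left_inv m] with y hy
    rw [hy, inv_smul_smul]
  · filter_upwards [h.right_inv m] with y hy
    rw [hy, inv_smul_smul]
  · have h3 := ENNReal.Tendsto.sub (tendsto_const_nhds (x := (1 : ENNReal)) (f := atTop (α := ℕ)))
      (h.equivariant g (Set.mem_univ g)) (Or.inl ENNReal.one_ne_top)
    rw [tsub_zero] at h3
    refine h3.congr fun m => ?_
    have h2 : MeasurableSet {y | T m (g • y) = g * T m y * g⁻¹} :=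
      measurableSet_eq_fun ((hT m).comp (measurable_const_smul g))
        (((hT m).const_mul g).mul_const g⁻¹)
    rw [← Set.compl_ofPred, prob_compl_eq_one_sub h2,
      ENNReal.sub_sub_cancel ENNReal.one_ne_top prob_le_one]
  · simp only [himg]
    rw [ENNReal.tendsto_nhds_zero]
    intro ε hε
    have hε' : ε / 3 ≠ 0 := (ENNReal.div_pos hε.ne' (by simp)).ne'
    obtain ⟨j, hj⟩ := hdense E hE (ε / 3) hε'
    filter_upwards [ENNReal.tendsto_nhds_zero.1 (h.trivial 1 j) (ε / 3)
      (pos_iff_ne_zero.2 hε')] with m hm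
    have hsub : {y | ¬ (U m y • y ∈ E ↔ y ∈ E)} ⊆
        {y | ¬ ((1 : G) • U m y • y ∈ B j ↔ (1 : G) • y ∈ B j)} ∪
        ((fun y => U m y • y) ⁻¹' symmDiff E (B j) ∪ symmDiff E (B j)) := by
      intro y hy
      simp only [Set.mem_union, Set.mem_preimage, Set.mem_symmDiff, Set.mem_ofPred_eq,
        one_smul] at hy ⊢
      tauto
    calc κ {y | ¬ (U m y • y ∈ E ↔ y ∈ E)} ≤ _ := measure_mono hsub
      _ ≤ _ := (measure_union_le _ _).trans (add_le_add_right (measure_union_le _ _) _)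
      _ ≤ ε / 3 + (ε / 3 + ε / 3) := by
        refine add_le_add hm (add_le_add ?_ hj.le)
        rw [(hUmp m).measure_preimage (hE.symmDiff (hB j)).nullMeasurableSet]
        exact hj.le
      _ = ε := by rw [← add_assoc, ENNReal.add_thirds]
  · refine (h.invariant g⁻¹ (Set.mem_univ _)).congr fun m => congrArg κ ?_
    ext y
    have : y ∈ (fun y : Y => g • y) '' A m ↔ g⁻¹ • y ∈ A m := by
      constructor
      · rintro ⟨z, hz, rfl⟩
        simpa using hz
      · exact fun hy => ⟨g⁻¹ • y, hy, by simp⟩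
    rw [Set.mem_symmDiff, this, Set.mem_ofPred_eq]
    tauto
  · exact (h.half_le m).trans_eq (himg m _).symm

/-- Stability data existing over almost every parameter can be chosen to be the restrictions of
globally defined maps and sets. -/
theorem exists_isStabilityData_of_ae {G X Y : Type*} [Group G] [Countable G]
    [MeasurableSpace G] [DiscreteMeasurableSpace G] [MeasurableSpace X] [StandardBorelSpace X]
    [MeasurableSpace Y] [StandardBorelSpace Y] [MulAction G Y] [MeasurableSMul₂ G Y]
    (μ : Measure X) [IsFiniteMeasure μ] (κ : ProbabilityTheory.Kernel X Y)
    [ProbabilityTheory.IsFiniteKernel κ] {π : Y → X} (hπ : Measurable π)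
    (hfib : ∀ᵐ x ∂μ, ∀ᵐ y ∂κ x, π y = x)
    {H : X → Set G} (hH : ∀ g, MeasurableSet {x | g ∈ H x})
    (hmp : ∀ᵐ x ∂μ, ∀ g ∈ H x, MeasurePreserving (fun y : Y => g • y) (κ x) (κ x))
    {B : ℕ → Set Y} (hB : ∀ j, MeasurableSet (B j))
    (hex : ∀ᵐ x ∂μ, ∃ (T U : ℕ → Y → G) (A : ℕ → Set Y), (∀ m, Measurable (T m)) ∧
      (∀ m, Measurable (U m)) ∧ (∀ m, MeasurableSet (A m)) ∧
      IsStabilityData B (κ x) (H x) T U A) :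
    ∃ (T U : ℕ → Y → G) (A : ℕ → Set Y), (∀ m, Measurable (T m)) ∧
      (∀ m, Measurable (U m)) ∧ (∀ m, MeasurableSet (A m)) ∧
      ∀ᵐ x ∂μ, IsStabilityData B (κ x) (H x) T U A := by
  obtain ⟨Φ, hΦ, hΦc⟩ := exists_universal_measurable Y (G × G × Prop)
  let Ω := ℕ → (G × G × Prop) → ℕ → ℕ
  let T : ℕ → (X × Ω) × Y → G := fun m q => (Φ (q.1.2 m, q.2)).1
  let U : ℕ → (X × Ω) × Y → G := fun m q => (Φ (q.1.2 m, q.2)).2.1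
  let A : ℕ → Set ((X × Ω) × Y) := fun m => {q | (Φ (q.1.2 m, q.2)).2.2}
  have hF : ∀ m, Measurable fun q : (X × Ω) × Y => Φ (q.1.2 m, q.2) := fun m =>
    hΦ.comp (((measurable_pi_apply m).comp (measurable_snd.comp measurable_fst)).prodMk
      measurable_snd)
  have hP := measurableSet_isStabilityData hB (κ.comap Prod.fst measurable_fst)
    (H := fun w : X × Ω => H w.1) (fun g => measurable_fst (hH g))
    (T := T) (U := U) (A := A) (fun m => (hF m).fst) (fun m => (hF m).snd.fst)
    (fun m => measurableSet_setOfPred.2 (hF m).snd.snd)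
  obtain ⟨f, hf, hfP⟩ := exists_measurable_selection_ae μ hP (by
    filter_upwards [hex, hmp] with x ⟨T₀, U₀, A₀, hT, hU, hA, h⟩ hx
    choose c hc using fun m => hΦc (κ x) (fun y => (T₀ m y, U₀ m y, y ∈ A₀ m))
      ((hT m).prodMk ((hU m).prodMk (measurableSet_setOfPred.1 (hA m))))
    refine ⟨c, h.congr hx fun m => ?_⟩
    filter_upwards [hc m] with y hy
    change _ = (Φ (c m, y)).1 ∧ _ = (Φ (c m, y)).2.1 ∧ (_ ↔ (Φ (c m, y)).2.2)
    rw [hy]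
    exact ⟨rfl, rfl, Iff.rfl⟩)
  have hq : Measurable fun y : Y => ((π y, f (π y)), y) :=
    (hπ.prodMk (hf.comp hπ)).prodMk measurable_id
  refine ⟨fun m y => T m ((π y, f (π y)), y), fun m y => U m ((π y, f (π y)), y),
    fun m => {y | ((π y, f (π y)), y) ∈ A m}, fun m => (hF m).fst.comp hq,
    fun m => (hF m).snd.fst.comp hq, fun m => hq (measurableSet_setOfPred.2 (hF m).snd.snd), ?_⟩
  filter_upwards [hfP, hmp, hfib] with x hx hx' hfibx
  refine IsStabilityData.congr hx hx' fun m => ?_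
  filter_upwards [hfibx] with y hy
  simp only [hy, and_self]

/-- A finite Borel subequivalence relation of an orbit equivalence relation has a measurable
choice of group elements moving each point to a canonical representative of its class. -/
theorem exists_measurable_representative {G X : Type*} [Group G] [Countable G]
    [MeasurableSpace G] [DiscreteMeasurableSpace G] [MeasurableSpace X] [StandardBorelSpace X]
    [MulAction G X] [MeasurableSMul₂ G X] {X' : Set X} (hX' : ∀ g : G, ∀ x ∈ X', g • x ∈ X')
    {S : X → X → Prop} (hS : MeasurableSet {p : X × X | S p.1 p.2})
    (hrefl : ∀ x ∈ X', S x x) (hsymm : ∀ x ∈ X', ∀ y ∈ X', S x y → S y x)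
    (htrans : ∀ x ∈ X', ∀ y ∈ X', ∀ z ∈ X', S x y → S y z → S x z)
    (hfin : ∀ x ∈ X', {y | S x y}.Finite) :
    ∃ h : X → G, Measurable h ∧
      ∀ x ∈ X', ∀ g : G, S x (g • x) → h (g • x) • g • x = h x • x := by
  let e := embeddingReal X
  have he : MeasurableEmbedding e := measurableEmbedding_embeddingReal X
  have hSg : ∀ g : G, MeasurableSet {x : X | S x (g • x)} := fun g =>
    (measurable_id.prodMk (measurable_const_smul g)) hS
  have hP : ∀ g : G, MeasurableSet
      {x : X | S x (g • x) ∧ ∀ g' : G, S x (g' • x) → e (g • x) ≤ e (g' • x)} := by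
    intro g
    rw [Set.ofPred_and, Set.ofPred_forall]
    refine (hSg g).inter (.iInter fun g' => ?_)
    simp only [imp_iff_not_or]
    exact (hSg g').compl.union (measurableSet_le (he.measurable.comp (measurable_const_smul g))
      (he.measurable.comp (measurable_const_smul g')))
  obtain ⟨h, hh, hhP⟩ := exists_measurable_mem_of_countable hP
  have hmin : ∀ x ∈ X', S x (h x • x) ∧ ∀ g' : G, S x (g' • x) → e (h x • x) ≤ e (g' • x) := by
    intro x hx
    apply hhP x
    obtain ⟨_, ⟨hy, g, rfl⟩, hmin⟩ := Set.exists_min_image {y | S x y ∧ ∃ g : G, g • x = y} e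
      ((hfin x hx).subset fun y hy => hy.1) ⟨x, hrefl x hx, 1, one_smul G x⟩
    exact ⟨g, hy, fun g' hg' => hmin _ ⟨hg', g', rfl⟩⟩
  refine ⟨h, hh, fun x hx g hg => he.injective (le_antisymm ?_ ?_)⟩
  · have hgx := hX' g x hx
    have := (hmin _ hgx).2 (h x * g⁻¹)
    rw [mul_smul, inv_smul_smul] at this
    exact this (htrans _ hgx _ hx _ (hX' _ _ hx) (hsymm _ hx _ hgx hg) (hmin x hx).1)
  · have hgx := hX' g x hx
    have := (hmin _ hx).2 (h (g • x) * g)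
    rw [mul_smul] at this
    exact this (htrans _ hx _ hgx _ (hX' _ _ hgx) hg (hmin _ hgx).1)

/-- The conjugate of the cocycle `T` by the cocycle `h`. -/
def conjCocycle {G Y : Type*} [Group G] [MulAction G Y] (h T : Y → G) (y : Y) : G :=
  (h y)⁻¹ * T (h y • y) * h y

theorem measurable_conjCocycle {G Y : Type*} [Group G] [Countable G]
    [MeasurableSpace G] [DiscreteMeasurableSpace G] [MulAction G Y]
    [MeasurableSpace Y] [MeasurableSMul₂ G Y] {h T : Y → G}
    (hh : Measurable h) (hT : Measurable T) : Measurable (conjCocycle h T) :=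
  (hh.inv.mul (hT.comp (hh.smul measurable_id))).mul hh

theorem conjCocycle_smul {G Y : Type*} [Group G] [MulAction G Y] (h T : Y → G) (y : Y) :
    conjCocycle h T y • y = (h y)⁻¹ • T (h y • y) • h y • y := by
  simp only [conjCocycle, mul_smul]

/-- Stability data for the stabilizer of `h x • x` induce stability data over `x` for all group
elements moving `x` to a point with the same representative. -/
theorem IsStabilityData.conj {G X Y : Type*} [Group G] [MulAction G X] [MulAction G Y]
    [MeasurableSpace G] [DiscreteMeasurableSpace G] [Countable G]
    [MeasurableSpace Y] [MeasurableSMul₂ G Y] {π : Y → X}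
    (hπ : ∀ (g : G) (y : Y), π (g • y) = g • π y) {κ : X → Measure Y} {h : X → G} {x : X}
    (hfib : ∀ᵐ y ∂κ x, π y = x)
    (hmp : MeasurePreserving (fun y : Y => h x • y) (κ x) (κ (h x • x)))
    {B : ℕ → Set Y} {T U : ℕ → Y → G} {A : ℕ → Set Y}
    (hd : IsStabilityData B (κ (h x • x)) (MulAction.stabilizer G (h x • x)) T U A) :
    IsStabilityData B (κ x) {g | h (g • x) • g • x = h x • x}
      (fun m => conjCocycle (fun y => h (π y)) (T m))
      (fun m => conjCocycle (fun y => h (π y)) (U m))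
      (fun m => {y | h (π y) • y ∈ A m}) := by
  have hae : ∀ {p : Y → Prop}, (∀ᵐ z ∂κ (h x • x), p z) → ∀ᵐ y ∂κ x, p (h x • y) :=
    fun hp => hmp.quasiMeasurePreserving.ae hp
  have hset : ∀ {p q : Y → Prop}, (∀ᵐ y ∂κ x, p y ↔ q (h x • y)) →
      κ (h x • x) {z | q z} = κ x {y | p y} := by
    intro p q hpq
    rw [← hmp.measure_preimage_emb (measurableEmbedding_const_smul (h x))]
    exact (measure_congr (eventuallyEq_set.2 hpq)).symm
  have hstab : ∀ {a : G}, a ∈ MulAction.stabilizer G (h x • x) →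
      (h x)⁻¹ • a • h x • x = x := fun ha => by
    rw [MulAction.mem_stabilizer_iff.1 ha, inv_smul_smul]
  have hk : ∀ {g : G}, h (g • x) • g • x = h x • x →
      h (g • x) * g * (h x)⁻¹ ∈ MulAction.stabilizer G (h x • x) := fun hg => by
    rw [MulAction.mem_stabilizer_iff, mul_smul, mul_smul, inv_smul_smul, hg]
  have hmem : ∀ {V : Y → G}, (∀ᵐ z ∂κ (h x • x), V z ∈ MulAction.stabilizer G (h x • x)) →
      ∀ᵐ y ∂κ x, conjCocycle (fun y => h (π y)) V y • x = x := by
    intro V hV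
    filter_upwards [hfib, hae hV] with y hy hVy
    rw [conjCocycle, hy, mul_smul, mul_smul, hstab hVy]
  have hinv : ∀ {V W : Y → G}, (∀ᵐ z ∂κ (h x • x), V z ∈ MulAction.stabilizer G (h x • x)) →
      (∀ᵐ z ∂κ (h x • x), W (V z • z) = (V z)⁻¹) →
      ∀ᵐ y ∂κ x, conjCocycle (fun y => h (π y)) W (conjCocycle (fun y => h (π y)) V y • y) =
        (conjCocycle (fun y => h (π y)) V y)⁻¹ := by
    intro V W hV hVW
    filter_upwards [hfib, hae hVW, hmem hV] with y hy hVWy hVy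
    have h1 : π (conjCocycle (fun y => h (π y)) V y • y) = x := by rw [hπ, hy, hVy]
    rw [conjCocycle, h1, conjCocycle_smul, hy, smul_inv_smul, hVWy]
    simp only [conjCocycle, hy, mul_inv_rev, inv_inv, mul_assoc]
  refine ⟨fun m => ?_, fun m => ?_, fun m => hinv (hd.mem_fst m) (hd.left_inv m),
    fun m => hinv (hd.mem_snd m) (hd.right_inv m), fun g hg => ?_, fun g j => ?_, fun g hg => ?_,
    fun m => ?_⟩
  · filter_upwards [hmem (hd.mem_fst m)] with y hy
    rw [hy]
  · filter_upwards [hmem (hd.mem_snd m)] with y hy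
    rw [hy]
  · refine (hd.equivariant _ (hk hg)).congr fun m => hset ?_
    filter_upwards [hfib] with y hy
    refine not_congr ?_
    simp only [conjCocycle, hπ, hy, mul_smul, inv_smul_smul, mul_inv_rev, inv_inv]
    constructor
    · intro heq
      rw [mul_assoc, inv_mul_eq_iff_eq_mul, ← eq_mul_inv_iff_mul_eq] at heq
      rw [heq]
      group
    · intro heq
      rw [heq]
      group
  · refine (hd.trivial (g * (h x)⁻¹) j).congr fun m => hset ?_
    filter_upwards [hfib] with y hy
    rw [conjCocycle_smul, hy]
    simp only [mul_smul, inv_smul_smul]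
  · refine (hd.invariant _ (hk hg)).congr fun m => hset ?_
    filter_upwards [hfib] with y hy
    simp only [hπ, hy, mul_smul, inv_smul_smul]
  · refine (hd.half_le m).trans_eq (hset ?_)
    filter_upwards [hfib, hmem (hd.mem_snd m)] with y hy hUy
    have h1 : π (conjCocycle (fun y => h (π y)) (U m) y • y) = x := by rw [hπ, hy, hUy]
    simp only [h1, hy]
    rw [conjCocycle_smul, hy, smul_inv_smul]

/-- A diagonal argument: countably many sequences of null sequences have a common null
diagonal. -/
theorem exists_diagonal_tendsto {ι : Type*} [Countable ι] {a : ι → ℕ → ℕ → ENNReal}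
    (ha : ∀ i n, Tendsto (a i n) atTop (nhds 0)) :
    ∃ m : ℕ → ℕ, ∀ i, Tendsto (fun n => a i n (m n)) atTop (nhds 0) := by
  obtain ⟨e, he⟩ := exists_injective_nat ι
  have hfin : ∀ n, {i | e i ≤ n}.Finite := fun n => (Set.finite_Iic n).preimage he.injOn
  have hex : ∀ n, ∃ k, ∀ i ∈ {i | e i ≤ n}, a i n k < ((n : ENNReal))⁻¹ := fun n =>
    ((hfin n).eventually_all.2 fun i _ =>
      (ha i n).eventually_lt_const (ENNReal.inv_pos.2 (ENNReal.natCast_ne_top n))).exists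
  choose m hm using hex
  refine ⟨m, fun i => tendsto_of_tendsto_of_tendsto_of_le_of_le' tendsto_const_nhds
    ENNReal.tendsto_inv_nat_nhds_zero (Eventually.of_forall fun n => zero_le) ?_⟩
  filter_upwards [eventually_ge_atTop (e i)] with n hn
  exact (hm n i hn).le

/-- Stability data on the fibres of a disintegration, for subsets of `G` exhausting `G` in measure,
yield stability data on the total space by passing to a diagonal sequence. -/
theorem exists_isStabilityData_of_fiberwise {G X Y : Type*} [Group G] [Countable G]
    [MeasurableSpace G] [DiscreteMeasurableSpace G] [MeasurableSpace X] [MeasurableSpace Y]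
    [MulAction G Y] [MeasurableSMul₂ G Y] {μ : Measure X} [IsProbabilityMeasure μ]
    {ν : Measure Y} (κ : ProbabilityTheory.Kernel X Y) [ProbabilityTheory.IsMarkovKernel κ]
    (hν : ∀ E, MeasurableSet E → ν E = ∫⁻ x, κ x E ∂μ) {π : Y → X} (hπ : MeasurePreserving π ν μ)
    (hfib : ∀ᵐ x ∂μ, ∀ᵐ y ∂κ x, π y = x) {H : ℕ → X → Set G}
    (hH : ∀ n g, MeasurableSet {x | g ∈ H n x})
    (hlim : ∀ g, Tendsto (fun n => μ {x | g ∉ H n x}) atTop (nhds 0))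
    {B : ℕ → Set Y} (hB : ∀ j, MeasurableSet (B j)) {T U : ℕ → ℕ → Y → G} {A : ℕ → ℕ → Set Y}
    (hT : ∀ n m, Measurable (T n m)) (hU : ∀ n m, Measurable (U n m))
    (hA : ∀ n m, MeasurableSet (A n m))
    (hd : ∀ᵐ x ∂μ, ∀ n, IsStabilityData B (κ x) (H n x) (T n) (U n) (A n)) :
    ∃ (T U : ℕ → Y → G) (A : ℕ → Set Y), (∀ m, Measurable (T m)) ∧
      (∀ m, Measurable (U m)) ∧ (∀ m, MeasurableSet (A m)) ∧
      IsStabilityData B ν Set.univ T U A := by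
  have hae : ∀ {p : Y → Prop}, Measurable p → (∀ᵐ x ∂μ, ∀ᵐ y ∂κ x, p y) → ∀ᵐ y ∂ν, p y := by
    intro p hp h
    rw [ae_iff, hν _ (measurableSet_setOfPred.2 hp.not)]
    exact (lintegral_congr_ae h).trans lintegral_zero
  have htend : ∀ {p : ℕ → Y → Prop}, (∀ m, Measurable (p m)) →
      (∀ᵐ x ∂μ, Tendsto (fun m => κ x {y | p m y}) atTop (nhds 0)) →
      Tendsto (fun m => ν {y | p m y}) atTop (nhds 0) := by
    intro p hp h
    have hm : ∀ m, MeasurableSet {y | p m y} := fun m => measurableSet_setOfPred.2 (hp m)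
    simp only [fun m => hν _ (hm m)]
    rw [← lintegral_zero (μ := μ)]
    refine tendsto_lintegral_of_dominated_convergence (fun _ => 1)
      (fun m => κ.measurable_coe (hm m)) (fun m => Eventually.of_forall fun x => prob_le_one)
      (by simp) h
  have heq : ∀ {f g : Y → G}, Measurable f → Measurable g → Measurable fun y => f y = g y :=
    fun hf hg => measurableSet_setOfPred.1 (measurableSet_eq_fun hf hg)
  have hmem : ∀ {C : Set Y} {f : Y → Y}, MeasurableSet C → Measurable f →
      Measurable fun y => f y ∈ C := fun hC hf => (measurableSet_setOfPred.1 hC).comp hf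
  have hg : ∀ g : G, Measurable fun y : Y => g • y := measurable_const_smul
  have hTy : ∀ n m, Measurable fun y => T n m y • y := fun n m => (hT n m).smul measurable_id
  have hUy : ∀ n m, Measurable fun y => U n m y • y := fun n m => (hU n m).smul measurable_id
  have hHπ : ∀ n g, Measurable fun y => g ∈ H n (π y) := fun n g =>
    (measurableSet_setOfPred.1 (hH n g)).comp hπ.measurable
  have hrestr : ∀ {n : ℕ} {g : G} {p : ℕ → Y → Prop}, (∀ m, Measurable (p m)) →
      (∀ᵐ x ∂μ, g ∈ H n x → Tendsto (fun m => κ x {y | p m y}) atTop (nhds 0)) →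
      Tendsto (fun m => ν {y | g ∈ H n (π y) ∧ p m y}) atTop (nhds 0) := by
    intro n g p hp h
    refine htend (fun m => (hHπ n g).and (hp m)) ?_
    filter_upwards [h, hfib] with x hx hfx
    by_cases hgx : g ∈ H n x
    · exact tendsto_of_tendsto_of_tendsto_of_le_of_le tendsto_const_nhds (hx hgx)
        (fun m => zero_le) fun m => measure_mono fun y hy => hy.2
    · refine tendsto_const_nhds.congr fun m => Eq.symm ?_
      refine measure_mono_null (t := {y | ¬ π y = x}) (fun y hy hy' => hgx ?_) hfx
      exact hy' ▸ hy.1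
  have hpe : ∀ n m (g : G), Measurable fun y => ¬ T n m (g • y) = g * T n m y * g⁻¹ :=
    fun n m g => (heq ((hT n m).comp (hg g)) (((hT n m).const_mul g).mul_const g⁻¹)).not
  have hpi : ∀ n m (g : G), Measurable fun y => ¬ (g • y ∈ A n m ↔ y ∈ A n m) :=
    fun n m g => ((hmem (hA n m) (hg g)).iff (hmem (hA n m) measurable_id)).not
  obtain ⟨k, hk⟩ := exists_diagonal_tendsto (ι := (G × ℕ))
    (a := fun i n m => ν {y | i.1 ∈ H n (π y) ∧ ¬ T n m (i.1 • y) = i.1 * T n m y * i.1⁻¹} +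
      ν {y | ¬ (i.1 • U n m y • y ∈ B i.2 ↔ i.1 • y ∈ B i.2)} +
      ν {y | i.1 ∈ H n (π y) ∧ ¬ (i.1 • y ∈ A n m ↔ y ∈ A n m)}) (by
    rintro ⟨g, j⟩ n
    have h1 := hrestr (n := n) (g := g) (fun m => hpe n m g)
      (hd.mono fun x hx hgx => (hx n).equivariant g hgx)
    have h2 := htend (p := fun m y => ¬ (g • U n m y • y ∈ B j ↔ g • y ∈ B j))
      (fun m => ((hmem (hB j) ((hUy n m).const_smul g)).iff (hmem (hB j) (hg g))).not)
      (hd.mono fun x hx => (hx n).trivial g j)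
    have h3 := hrestr (n := n) (g := g) (fun m => hpi n m g)
      (hd.mono fun x hx hgx => (hx n).invariant g hgx)
    simpa using (h1.add h2).add h3)
  have hfull : ∀ {g : G} {p : ℕ → Y → Prop},
      Tendsto (fun n => ν {y | g ∈ H n (π y) ∧ p n y}) atTop (nhds 0) →
      Tendsto (fun n => ν {y | p n y}) atTop (nhds 0) := by
    intro g p hp
    have := hp.add (hlim g)
    rw [add_zero] at this
    refine tendsto_of_tendsto_of_tendsto_of_le_of_le tendsto_const_nhds this
      (fun n => zero_le) fun n => ?_
    have hc : MeasurableSet {x | g ∉ H n x} := (hH n g).compl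
    dsimp only
    rw [← hπ.measure_preimage hc.nullMeasurableSet]
    refine (measure_mono fun y hy => ?_).trans (measure_union_le _ _)
    by_cases hgy : g ∈ H n (π y)
    · exact Or.inl ⟨hgy, hy⟩
    · exact Or.inr hgy
  have hle : ∀ {i : G × ℕ} {b : ℕ → ENNReal}, (∀ n, b n ≤ _) → Tendsto b atTop (nhds 0) :=
    fun {i b} hb => tendsto_of_tendsto_of_tendsto_of_le_of_le tendsto_const_nhds (hk i)
      (fun n => zero_le) hb
  refine ⟨fun n => T n (k n), fun n => U n (k n), fun n => A n (k n), fun n => hT n _,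
    fun n => hU n _, fun n => hA n _, fun n => ?_, fun n => ?_, fun n => ?_, fun n => ?_,
    fun g _ => ?_, fun g j => ?_, fun g _ => ?_, fun n => ?_⟩
  · exact Eventually.of_forall fun y => Set.mem_univ _
  · exact Eventually.of_forall fun y => Set.mem_univ _
  · exact hae (heq ((hU n _).comp (hTy n _)) (hT n _).inv) (hd.mono fun x hx => (hx n).left_inv _)
  · exact hae (heq ((hT n _).comp (hUy n _)) (hU n _).inv) (hd.mono fun x hx => (hx n).right_inv _)
  · exact hfull (g := g) (hle (i := (g, 0)) fun n => le_self_add.trans le_self_add)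
  · exact hle (i := (g, j)) fun n => le_add_self.trans le_self_add
  · exact hfull (g := g) (hle (i := (g, 0)) fun n => le_add_self)
  · have hm : MeasurableSet {y | ¬ (U n (k n) y • y ∈ A n (k n) ↔ y ∈ A n (k n))} :=
      measurableSet_setOfPred.2
        ((hmem (hA n _) (hUy n _)).iff (hmem (hA n _) measurable_id)).not
    rw [hν _ hm]
    calc (1 / 2 : ENNReal) = ∫⁻ _, 1 / 2 ∂μ := by simp
      _ ≤ _ := lintegral_mono_ae (hd.mono fun x hx => (hx n).half_le (k n))

/-- Theorem on stability sequences from fiberwise stability sequences: if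
`π : (Y, ν) → (X, μ)` is an equivariant factor map with equivariant disintegration
`(ν_x)`, the orbit equivalence relation of `G ↷ (X, μ)` is hyperfinite (an increasing
union of finite Borel equivalence relations on a conull invariant set), and for `μ`-a.e.
`x` the action of the stabilizer `G_x` on the fiber `(π⁻¹(x), ν_x)` admits a stability
sequence, then `G ↷ (Y, ν)` admits a stability sequence. -/
theorem stmt19 {G X Y : Type*} [Group G] [Countable G]
    [MeasurableSpace X] [StandardBorelSpace X] [MeasurableSpace Y] [StandardBorelSpace Y]
    (μ : Measure X) [IsProbabilityMeasure μ] (ν : Measure Y) [IsProbabilityMeasure ν]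
    [MulAction G X] [MulAction G Y]
    (hmX : ∀ g : G, MeasurePreserving (fun x : X => g • x) μ μ)
    (hmY : ∀ g : G, MeasurePreserving (fun y : Y => g • y) ν ν)
    (π : Y → X) (hπmp : MeasurePreserving π ν μ)
    (hπeq : ∀ (g : G) (y : Y), π (g • y) = g • π y)
    (νx : X → Measure Y)
    (hprob : ∀ x : X, IsProbabilityMeasure (νx x))
    (hmeasfam : ∀ B : Set Y, MeasurableSet B → Measurable fun x => νx x B)
    (hfiber : ∀ᵐ x ∂μ, νx x (π ⁻¹' {x}) = 1)
    (hdisint : ∀ B : Set Y, MeasurableSet B → ν B = ∫⁻ x, νx x B ∂μ)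
    (hequivdis : ∀ g : G, ∀ᵐ x ∂μ,
      Measure.map (fun y : Y => g • y) (νx x) = νx (g • x))
    (hhyperfinite : ∃ X' : Set X, MeasurableSet X' ∧ μ X' = 1 ∧
      (∀ g : G, ∀ x ∈ X', g • x ∈ X') ∧
      ∃ S : ℕ → X → X → Prop,
        (∀ n, MeasurableSet {p : X × X | S n p.1 p.2}) ∧
        (∀ n, ∀ x ∈ X', S n x x) ∧
        (∀ n, ∀ x ∈ X', ∀ y ∈ X', S n x y → S n y x) ∧
        (∀ n, ∀ x ∈ X', ∀ y ∈ X', ∀ z ∈ X', S n x y → S n y z → S n x z) ∧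
        (∀ n x y, S n x y → S (n + 1) x y) ∧
        (∀ n, ∀ x ∈ X', {y | S n x y}.Finite) ∧
        (∀ x ∈ X', ∀ y ∈ X', ((∃ n, S n x y) ↔ ∃ g : G, g • x = y)))
    (hstab : ∀ᵐ x ∂μ, HasStabilitySeq (νx x)
      (fun (g : MulAction.stabilizer G x) (y : Y) => (g : G) • y)) :
    HasStabilitySeq ν (fun (g : G) (y : Y) => g • y) := by
  obtain ⟨X', hX'm, hX'1, hX', S, hS, hrefl, hsymm, htrans, hmono, hfin, hunion⟩ := hhyperfinite
  let _ : MeasurableSpace G := ⊤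
  have : DiscreteMeasurableSpace G := ⟨fun _ => trivial⟩
  have : MeasurableSMul₂ G X := ⟨measurable_from_prod_countable_right fun g => (hmX g).measurable⟩
  have : MeasurableSMul₂ G Y := ⟨measurable_from_prod_countable_right fun g => (hmY g).measurable⟩
  let κ : ProbabilityTheory.Kernel X Y := ⟨νx, Measure.measurable_of_measurable_coe _ hmeasfam⟩
  have : ProbabilityTheory.IsMarkovKernel κ := ⟨hprob⟩
  have hfib : ∀ᵐ x ∂μ, ∀ᵐ y ∂κ x, π y = x := by
    filter_upwards [hfiber] with x hx
    exact (prob_compl_eq_zero_iff (μ := κ x) (hπmp.measurable (measurableSet_singleton x))).2 hx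
  have hmp : ∀ᵐ x ∂μ, ∀ g : G, MeasurePreserving (fun y : Y => g • y) (κ x) (κ (g • x)) := by
    filter_upwards [ae_all_iff.2 hequivdis] with x hx g
    exact ⟨measurable_const_smul g, hx g⟩
  have hmpstab : ∀ᵐ x ∂μ, ∀ g ∈ (MulAction.stabilizer G x : Set G),
      MeasurePreserving (fun y : Y => g • y) (κ x) (κ x) := by
    filter_upwards [hmp] with x hx g hg
    have := hx g
    rwa [MulAction.mem_stabilizer_iff.1 hg] at this
  obtain ⟨B, hB, hdense⟩ := exists_seq_measurableSet_dense Y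
  obtain ⟨T, U, A, hT, hU, hA, hd⟩ := exists_isStabilityData_of_ae μ κ hπmp.measurable hfib
    (H := fun x => (MulAction.stabilizer G x : Set G))
    (fun g => measurableSet_eq_fun (measurable_const_smul g) measurable_id) hmpstab hB (by
      filter_upwards [hstab, hmpstab] with x hx hmpx
      exact hx.exists_isStabilityData hmpx hB)
  choose h hh hhS using fun n => exists_measurable_representative hX' (hS n) (hrefl n) (hsymm n)
    (htrans n) (hfin n)
  have hall : ∀ᵐ x ∂μ, ∀ g : G,
      IsStabilityData B (κ (g • x)) (MulAction.stabilizer G (g • x)) T U A :=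
    ae_all_iff.2 fun g => (hmX g).quasiMeasurePreserving.ae hd
  have hX'ae : ∀ᵐ x ∂μ, x ∈ X' := (prob_compl_eq_zero_iff hX'm).2 hX'1
  have hSg : ∀ n (g : G), MeasurableSet {x : X | S n x (g • x)} := fun n g =>
    (measurable_id.prodMk (measurable_const_smul g)) (hS n)
  have hlim : ∀ g : G, Tendsto (fun n => μ {x | ¬ S n x (g • x)}) atTop (nhds 0) := by
    intro g
    have h0 : μ (⋂ n, {x | ¬ S n x (g • x)}) = 0 := by
      refine measure_mono_null (t := X'ᶜ) (fun x hx hxX' => ?_) hX'ae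
      obtain ⟨n, hn⟩ := (hunion x hxX' _ (hX' g x hxX')).2 ⟨g, rfl⟩
      exact Set.mem_iInter.1 hx n hn
    rw [← h0]
    exact tendsto_measure_iInter_atTop (fun n => (hSg n g).compl.nullMeasurableSet)
      (antitone_nat_of_succ_le fun n x hx hx' => hx (hmono n _ _ hx')) ⟨0, measure_ne_top _ _⟩
  obtain ⟨T', U', A', hT', hU', hA', hd'⟩ := exists_isStabilityData_of_fiberwise κ hdisint hπmp
    hfib (H := fun n x => {g : G | h n (g • x) • g • x = h n x • x})
    (fun n g => measurableSet_eq_fun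
      (((hh n).comp (measurable_const_smul g)).smul (measurable_const_smul g))
      ((hh n).smul measurable_id))
    (fun g => tendsto_of_tendsto_of_tendsto_of_le_of_le tendsto_const_nhds (hlim g)
      (fun n => zero_le) fun n => measure_mono_ae (by
        filter_upwards [hX'ae] with x hx hgx hSx
        exact hgx (hhS n x hx g hSx))) hB
    (fun n m => measurable_conjCocycle ((hh n).comp hπmp.measurable) (hT m))
    (fun n m => measurable_conjCocycle ((hh n).comp hπmp.measurable) (hU m))
    (fun n m => (((hh n).comp hπmp.measurable).smul measurable_id) (hA m)) (by
      filter_upwards [hfib, hmp, hall] with x hfx hmpx hx n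
      exact IsStabilityData.conj hπeq hfx (hmpx (h n x)) (hx (h n x)))
  exact hd'.hasStabilitySeq hmY hB (fun E hE ε hε => hdense ν E hE ε hε) hT' hU' hA'
end
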